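/- arXiv:2009.13976 — 14 statements merged into one kernel-verified Lean document; each statement's English description precedes it below -/
import Mathlib

section
/- For every integer n ≥ 1 there exists a constant c > 0 such that for every λ = (λ_1,…,λ_{n+1}) ∈ ℝ^{n+1} with λ_1 ≥ λ_2 ≥ ⋯ ≥ λ_{n+1}, with λ_1 + ⋯ + λ_{n+1} = 0 and with Euclidean norm ‖λ‖ ≥ 1, one has ∏_{1 ≤ i < j ≤ n+1} (1 + λ_i − λ_j) ≥ c‖λ‖^n. -/
/-- Each row of the product is at least its last factor. -/
lemma one_add_sub_last_le_prod_Ioi {n : ℕ} {f : Fin (n + 1) → ℝ} (hf : Antitone f)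
    (i : Fin (n + 1)) :
    1 + f i - f (Fin.last n) ≤ ∏ j ∈ Finset.Ioi i, (1 + f i - f j) := by
  have h1 : ∀ j ∈ Finset.Ioi i, 1 ≤ 1 + f i - f j := fun j hj => by
    linarith [hf (Finset.mem_Ioi.mp hj).le]
  rcases (Fin.le_last i).eq_or_lt with rfl | hi
  · simpa using Finset.one_le_prod h1
  · rw [← Finset.mul_prod_erase _ _ (Finset.mem_Ioi.mpr hi)]
    refine le_mul_of_one_le_right (by linarith [h1 _ (Finset.mem_Ioi.mpr hi)]) ?_
    exact Finset.one_le_prod fun j hj => h1 j (Finset.mem_of_mem_erase hj)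

lemma one_add_sub_pow_le_prod_Ioi {n : ℕ} {f : Fin (n + 1) → ℝ} (hf : Antitone f) :
    (1 + f 0 - f (Fin.last n)) ^ n ≤ ∏ i, ∏ j ∈ Finset.Ioi i, (1 + f i - f j) := by
  have h0 : ∀ i, f i ≤ f 0 := fun i => hf (Fin.zero_le i)
  have hl : ∀ i, f (Fin.last n) ≤ f i := fun i => hf (Fin.le_last i)
  rw [Fin.prod_univ_succ, Fin.prod_Ioi_zero, ← Finset.prod_mul_distrib]
  calc (1 + f 0 - f (Fin.last n)) ^ n
      = ∏ _i : Fin n, (1 + f 0 - f (Fin.last n)) := by simp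
    _ ≤ _ := by
      refine Finset.prod_le_prod (fun i _ => by linarith [h0 (Fin.last n)]) fun i _ => ?_
      calc 1 + f 0 - f (Fin.last n)
          ≤ (1 + f 0 - f i.succ) * (1 + f i.succ - f (Fin.last n)) := by
            nlinarith [mul_nonneg (sub_nonneg.mpr (h0 i.succ)) (sub_nonneg.mpr (hl i.succ))]
        _ ≤ _ := mul_le_mul_of_nonneg_left (one_add_sub_last_le_prod_Ioi hf i.succ)
            (by linarith [h0 i.succ])

lemma norm_le_mul_sub_last {n : ℕ} {l : EuclideanSpace ℝ (Fin (n + 1))} (hl : Antitone l)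
    (hsum : ∑ i, l i = 0) : ‖l‖ ≤ (n + 1) * (l 0 - l (Fin.last n)) := by
  have h0 : ∀ i, l i ≤ l 0 := fun i => hl (Fin.zero_le i)
  have hlast : ∀ i, l (Fin.last n) ≤ l i := fun i => hl (Fin.le_last i)
  have hn : (0 : ℝ) < n + 1 := by positivity
  have hpos : 0 ≤ l 0 := by
    have := Finset.sum_le_card_nsmul Finset.univ (fun i => l i) _ fun i _ => h0 i
    simp only [hsum, Finset.card_univ, Fintype.card_fin, nsmul_eq_mul] at this
    push_cast at this
    exact nonneg_of_mul_nonneg_right this hn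
  have hneg : l (Fin.last n) ≤ 0 := by
    have := Finset.card_nsmul_le_sum Finset.univ (fun i => l i) _ fun i _ => hlast i
    simp only [hsum, Finset.card_univ, Fintype.card_fin, nsmul_eq_mul] at this
    push_cast at this
    exact nonpos_of_mul_nonpos_right this hn
  have hD : 0 ≤ l 0 - l (Fin.last n) := by linarith
  refine le_of_sq_le_sq ?_ (by positivity)
  rw [EuclideanSpace.norm_sq_eq]
  calc ∑ i, ‖l i‖ ^ 2 ≤ ∑ _i : Fin (n + 1), (l 0 - l (Fin.last n)) ^ 2 := by
        refine Finset.sum_le_sum fun i _ => pow_le_pow_left₀ (norm_nonneg _) ?_ 2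
        rw [Real.norm_eq_abs, abs_le]
        constructor <;> linarith [h0 i, hlast i]
    _ = (n + 1) * (l 0 - l (Fin.last n)) ^ 2 := by simp
    _ ≤ ((n + 1) * (l 0 - l (Fin.last n))) ^ 2 := by
        rw [mul_pow]
        refine mul_le_mul_of_nonneg_right ?_ (sq_nonneg _)
        nlinarith [(Nat.cast_nonneg n : (0 : ℝ) ≤ n)]

/-- For every integer `n ≥ 1` there exists `c > 0` such that for every
`λ ∈ ℝ^{n+1}` with nonincreasing coordinates, coordinate sum zero, and Euclidean norm at
least 1, one has `∏_{i<j} (1 + λ_i − λ_j) ≥ c ‖λ‖^n`. -/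
theorem stmt_0 (n : ℕ) (hn : 1 ≤ n) :
    ∃ c : ℝ, 0 < c ∧ ∀ l : EuclideanSpace ℝ (Fin (n + 1)),
      (∀ i j : Fin (n + 1), i ≤ j → l j ≤ l i) →
      (∑ i, l i) = 0 →
      1 ≤ ‖l‖ →
      c * ‖l‖ ^ n ≤ ∏ i : Fin (n + 1), ∏ j ∈ Finset.Ioi i, (1 + l i - l j) := by
  refine ⟨((n + 1 : ℝ)⁻¹) ^ n, by positivity, fun l hl hsum _ => ?_⟩
  have hanti : Antitone l := fun i j hij => hl i j hij
  refine le_trans ?_ (one_add_sub_pow_le_prod_Ioi hanti)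
  rw [← mul_pow]
  refine pow_le_pow_left₀ (by positivity) ?_ n
  rw [inv_mul_le_iff₀ (by positivity)]
  refine (norm_le_mul_sub_last hanti hsum).trans ?_
  gcongr
  linarith
end

section
/- Let n ≥ 2 and let η_0 ≥ 1, η_1 ≥ 0, η_2 ≥ 0 be integers. There exists a constant c > 0 such that for every λ = (λ_1,…,λ_n) ∈ ℝ^n with λ_1 ≥ λ_2 ≥ ⋯ ≥ λ_n ≥ 0 and Euclidean norm ‖λ‖ ≥ 1, one has ∏_{1 ≤ i < j ≤ n} [(1 + λ_i − λ_j)(1 + λ_i + λ_j)]^{η_0} · ∏_{i=1}^n (1 + λ_i)^{η_1}(1 + 2λ_i)^{η_2} ≥ c‖λ‖^{η_0(2n−3) + η_1 + η_2}. -/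
/-- The factors attached to `e₀ ± e_j` and `e₁ ± e_j` already contribute `(1 + λ₀) ^ (2n - 3)`. -/
theorem one_add_pow_le_prod_pairs {m : ℕ} (x : Fin (m + 2) → ℝ)
    (hx : ∀ i j, i ≤ j → x j ≤ x i) (h0 : ∀ i, 0 ≤ x i) :
    (1 + x 0) ^ (2 * m + 1) ≤
      ∏ i, ∏ j ∈ Finset.Ioi i, ((1 + x i - x j) * (1 + x i + x j)) := by
  have one_le : ∀ i j, i ≤ j → 1 ≤ (1 + x i - x j) * (1 + x i + x j) := fun i j hij =>
    one_le_mul_of_one_le_of_one_le (by linarith [hx i j hij]) (by linarith [h0 i, h0 j])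
  have rest : 1 ≤ ∏ i : Fin m, ∏ j ∈ Finset.Ioi i.succ.succ,
      ((1 + x i.succ.succ - x j) * (1 + x i.succ.succ + x j)) :=
    Finset.one_le_prod fun i _ => Finset.one_le_prod fun j hj =>
      one_le _ _ (Finset.mem_Ioi.mp hj).le
  have first : 1 + x 0 ≤ (1 + x 0 - x 1) * (1 + x 0 + x 1) := by
    nlinarith [hx 0 1 (Fin.zero_le _), h0 0, h0 1,
      mul_nonneg (sub_nonneg.2 (hx 0 1 (Fin.zero_le _))) (add_nonneg (h0 0) (h0 1))]
  have pair : ((1 + x 0) ^ 2) ^ m ≤ ∏ j : Fin m,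
      (((1 + x 0 - x j.succ.succ) * (1 + x 0 + x j.succ.succ)) *
        ((1 + x 1 - x j.succ.succ) * (1 + x 1 + x j.succ.succ))) := by
    have := Finset.prod_le_prod (s := Finset.univ) (f := fun _ : Fin m => (1 + x 0) ^ 2)
      (g := fun j : Fin m => ((1 + x 0 - x j.succ.succ) * (1 + x 0 + x j.succ.succ)) *
        ((1 + x 1 - x j.succ.succ) * (1 + x 1 + x j.succ.succ)))
      (fun _ _ => by positivity) (fun j _ => ?_)
    · simpa using this
    · have ha := h0 j.succ.succ
      have hab : x j.succ.succ ≤ x 1 := hx _ _ (by simp [Fin.le_def])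
      have hbM : x 1 ≤ x 0 := hx _ _ (Fin.zero_le _)
      generalize x j.succ.succ = a at *
      have e1 : 1 + x 0 ≤ 1 + x 0 + a := by linarith
      have e2 : 1 + x 0 ≤ (1 + x 0 - a) * (1 + x 1 + a) := by
        nlinarith [mul_nonneg ha (sub_nonneg.2 (hab.trans hbM)),
          mul_nonneg (h0 1) (sub_nonneg.2 (hab.trans hbM)), h0 1]
      have e3 : 1 ≤ 1 + x 1 - a := by linarith
      have hM : 0 ≤ 1 + x 0 := by linarith [h0 0]
      calc (1 + x 0) ^ 2 = (1 + x 0) * (1 + x 0) * 1 := by ring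
        _ ≤ (1 + x 0 + a) * ((1 + x 0 - a) * (1 + x 1 + a)) * (1 + x 1 - a) := by
          gcongr
          exact mul_nonneg (hM.trans e1) (hM.trans e2)
        _ = _ := by ring
  rw [Fin.prod_univ_succ, Fin.prod_univ_succ]
  simp only [Fin.prod_Ioi_zero, Fin.prod_Ioi_succ,
    Fin.prod_univ_succ (n := m)]
    at rest ⊢
  rw [Fin.succ_zero_eq_one]
  rw [Finset.prod_mul_distrib] at pair
  have hM : 0 ≤ 1 + x 0 := by linarith [h0 0]
  calc (1 + x 0) ^ (2 * m + 1) = (1 + x 0) * ((1 + x 0) ^ 2) ^ m * 1 := by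
          rw [pow_succ, pow_mul, mul_one, mul_comm]
    _ ≤ _ := mul_le_mul (mul_le_mul first pair (by positivity) (hM.trans first)) rest zero_le_one
        (mul_nonneg (hM.trans first) ((by positivity : (0 : ℝ) ≤ _).trans pair))
    _ = _ := by ring

theorem EuclideanSpace.norm_le_card_mul_of_norm_le {n : ℕ} (l : EuclideanSpace ℝ (Fin n)) {M : ℝ}
    (hM : 0 ≤ M) (h : ∀ i, ‖l i‖ ≤ M) : ‖l‖ ≤ n * M := by
  rw [EuclideanSpace.norm_eq]
  apply Real.sqrt_le_iff.2 ⟨by positivity, ?_⟩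
  calc ∑ i, ‖l i‖ ^ 2 ≤ ∑ _i : Fin n, M ^ 2 := by gcongr with i; exact h i
    _ = n * M ^ 2 := by simp
    _ ≤ (n : ℝ) ^ 2 * M ^ 2 := by
      gcongr
      exact_mod_cast Nat.le_self_pow two_ne_zero n
    _ = _ := by ring


/-- key product lower bound for types `B_n`, `C_n`, `BC_n`:
for `λ` with nonincreasing nonnegative coordinates and `‖λ‖ ≥ 1`,
`∏_{i<j} [(1+λ_i−λ_j)(1+λ_i+λ_j)]^{η₀} · ∏_i (1+λ_i)^{η₁}(1+2λ_i)^{η₂}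
  ≥ c ‖λ‖^{η₀(2n−3)+η₁+η₂}`. -/
theorem stmt_1 (n : ℕ) (hn : 2 ≤ n) (η₀ η₁ η₂ : ℕ) (hη₀ : 1 ≤ η₀) :
    ∃ c : ℝ, 0 < c ∧ ∀ l : EuclideanSpace ℝ (Fin n),
      (∀ i j : Fin n, i ≤ j → l j ≤ l i) →
      (∀ i, 0 ≤ l i) →
      1 ≤ ‖l‖ →
      c * ‖l‖ ^ (η₀ * (2 * n - 3) + η₁ + η₂) ≤
        (∏ i : Fin n, ∏ j ∈ Finset.Ioi i, ((1 + l i - l j) * (1 + l i + l j)) ^ η₀) *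
          ∏ i : Fin n, (1 + l i) ^ η₁ * (1 + 2 * l i) ^ η₂ := by
  obtain ⟨m, rfl⟩ : ∃ m, n = m + 2 := ⟨n - 2, by omega⟩
  refine ⟨((((m + 2 : ℕ) : ℝ)) ^ (η₀ * (2 * (m + 2) - 3) + η₁ + η₂))⁻¹, by positivity, ?_⟩
  intro l hl h0 _
  have hM : 0 ≤ 1 + l 0 := by linarith [h0 0]
  have hnorm : ‖l‖ ≤ ((m + 2 : ℕ) : ℝ) * (1 + l 0) :=
    EuclideanSpace.norm_le_card_mul_of_norm_le l hM fun i => by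
      rw [Real.norm_of_nonneg (h0 i)]
      linarith [hl 0 i (Fin.zero_le _)]
  have hpairs := one_add_pow_le_prod_pairs (fun i => l i) hl h0
  have hsingle : (1 + l 0) ^ (η₁ + η₂) ≤
      ∏ i, (1 + l i) ^ η₁ * (1 + 2 * l i) ^ η₂ := by
    rw [Fin.prod_univ_succ, pow_add]
    have hrest : 1 ≤ ∏ i : Fin (m + 1), (1 + l i.succ) ^ η₁ * (1 + 2 * l i.succ) ^ η₂ :=
      Finset.one_le_prod fun i _ => one_le_mul_of_one_le_of_one_le
        (one_le_pow₀ (by linarith [h0 i.succ])) (one_le_pow₀ (by linarith [h0 i.succ]))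
    have h2 : 1 + l 0 ≤ 1 + 2 * l 0 := by linarith [h0 0]
    have h2' : 0 ≤ 1 + 2 * l 0 := hM.trans h2
    refine le_trans ?_ (le_mul_of_one_le_right (by positivity) hrest)
    gcongr
  rw [inv_mul_le_iff₀ (by positivity)]
  simp only [Finset.prod_pow]
  calc ‖l‖ ^ (η₀ * (2 * (m + 2) - 3) + η₁ + η₂)
      ≤ (((m + 2 : ℕ) : ℝ) * (1 + l 0)) ^ (η₀ * (2 * (m + 2) - 3) + η₁ + η₂) := by gcongr
    _ = ((m + 2 : ℕ) : ℝ) ^ (η₀ * (2 * (m + 2) - 3) + η₁ + η₂) *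
        (((1 + l 0) ^ (2 * m + 1)) ^ η₀ * (1 + l 0) ^ (η₁ + η₂)) := by
      rw [mul_pow, ← pow_mul, ← pow_add, show 2 * (m + 2) - 3 = 2 * m + 1 by omega,
        mul_comm η₀, add_assoc]
    _ ≤ _ := by
      refine mul_le_mul_of_nonneg_left (mul_le_mul (pow_le_pow_left₀ (by positivity) hpairs _)
        hsingle (by positivity) (pow_nonneg ((by positivity : (0 : ℝ) ≤ _).trans hpairs) _))
        (by positivity)
end

section
/- Let n ≥ 4. There exists a constant c > 0 such that for every λ = (λ_1,…,λ_n) ∈ ℝ^n with λ_1 ≥ λ_2 ≥ ⋯ ≥ λ_{n−1} ≥ |λ_n| and Euclidean norm ‖λ‖ ≥ 1, one has ∏_{1 ≤ i < j ≤ n} (1 + λ_i − λ_j)(1 + λ_i + λ_j) ≥ c‖λ‖^{2(n−1)}. -/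
theorem one_add_mul_one_add_sub_abs_le {a b : ℝ} (h : |b| ≤ a) :
    (1 + a) * (1 + a - |b|) ≤ (1 + a - b) * (1 + a + b) := by
  have h0 := abs_nonneg b
  have h1 : (1 + a - b) * (1 + a + b) = (1 + a - |b|) * (1 + a + |b|) := by
    linear_combination sq_abs b
  rw [h1]
  nlinarith

theorem one_add_le_mul {a b : ℝ} (h : |b| ≤ a) :
    1 + a ≤ (1 + a - b) * (1 + a + b) := by
  have h0 := abs_nonneg b
  refine le_trans ?_ (one_add_mul_one_add_sub_abs_le h)
  nlinarith

/-- If every coordinate dominates the absolute values of all later ones, the product over the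
positive roots of `D_n` is at least `(1 + v 0) ^ (2 * (n - 1))`, where `n = m + 4`. -/
theorem pow_le_prod_roots (m : ℕ) (v : Fin (m + 4) → ℝ)
    (H : ∀ i j : Fin (m + 4), i < j → |v j| ≤ v i) :
    (1 + v 0) ^ (2 * (m + 3)) ≤
      ∏ i, ∏ j ∈ Finset.Ioi i, (1 + v i - v j) * (1 + v i + v j) := by
  set F : Fin (m + 4) → Fin (m + 4) → ℝ := fun i j => (1 + v i - v j) * (1 + v i + v j)
  change _ ≤ ∏ i, ∏ j ∈ Finset.Ioi i, F i j
  have hlow : ∀ i j, i < j → 1 + v i ≤ F i j := fun i j hij => one_add_le_mul (H i j hij)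
  have hone : ∀ i j, i < j → 1 ≤ F i j := fun i j hij => by
    linarith [hlow i j hij, H i j hij, abs_nonneg (v j)]
  set t := v 0
  set a := v (Fin.succ 0) with ha
  set b := v (Fin.succ (Fin.succ 0))
  have hb0 : 0 ≤ b := (abs_nonneg _).trans
    (H (Fin.succ (Fin.succ 0)) (Fin.succ (Fin.succ (Fin.succ 0)))
      (Fin.succ_lt_succ_iff.2 (Fin.succ_lt_succ_iff.2 (Fin.succ_pos 0))))
  have hba : b ≤ a := (le_abs_self _).trans
    (H (Fin.succ 0) (Fin.succ (Fin.succ 0)) (Fin.succ_lt_succ_iff.2 (Fin.succ_pos 0)))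
  have hat : a ≤ t := (le_abs_self _).trans (H 0 (Fin.succ 0) (Fin.succ_pos 0))
  have row0 : (1 + t) * (1 + t - a) * ((1 + t) * (1 + t - b)) ^ (m + 2)
      ≤ ∏ j ∈ Finset.Ioi 0, F 0 j := by
    rw [Fin.prod_Ioi_zero, Fin.prod_univ_succ]
    have h1 : (1 + t) * (1 + t - a) ≤ F 0 (Fin.succ 0) := by
      have := one_add_mul_one_add_sub_abs_le (H 0 (Fin.succ 0) (Fin.succ_pos 0))
      rwa [← ha, abs_of_nonneg (hb0.trans hba)] at this
    have h2 : ((1 + t) * (1 + t - b)) ^ (m + 2) ≤ ∏ j : Fin (m + 2), F 0 j.succ.succ := by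
      have := Finset.prod_le_prod (s := (Finset.univ : Finset (Fin (m + 2))))
        (f := fun _ => (1 + t) * (1 + t - b)) (g := fun j => F 0 j.succ.succ)
        (fun _ _ => mul_nonneg (by linarith) (by linarith)) (fun j _ => by
          have hj := H 0 j.succ.succ (Fin.succ_pos _)
          refine le_trans ?_ (one_add_mul_one_add_sub_abs_le hj)
          have hjb : |v j.succ.succ| ≤ b := by
            rcases Fin.eq_zero_or_eq_succ j with rfl | ⟨k, rfl⟩
            · exact (abs_of_nonneg hb0).le
            · exact H _ _ (Fin.succ_lt_succ_iff.2 (Fin.succ_lt_succ_iff.2 k.succ_pos))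
          exact mul_le_mul_of_nonneg_left (by linarith) (by linarith))
      simpa using this
    exact mul_le_mul h1 h2
      (pow_nonneg (mul_nonneg (by linarith) (by linarith)) _)
      (le_trans (mul_nonneg (by linarith) (by linarith)) h1)
  have row1 : (1 + a) ^ (m + 2) ≤ ∏ j ∈ Finset.Ioi (Fin.succ 0), F (Fin.succ 0) j := by
    have := Finset.prod_le_prod (s := Finset.Ioi (Fin.succ 0 : Fin (m + 4)))
      (f := fun _ => 1 + a) (g := fun j => F (Fin.succ 0) j)
      (fun _ _ => by linarith) (fun j hj => hlow _ _ (Finset.mem_Ioi.1 hj))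
    simpa using this
  have row2 : (1 + b) ^ (m + 1) ≤
      ∏ j ∈ Finset.Ioi (Fin.succ (Fin.succ 0)), F (Fin.succ (Fin.succ 0)) j := by
    rw [Fin.prod_Ioi_succ, Fin.prod_Ioi_succ, Fin.prod_Ioi_zero]
    have := Finset.prod_le_prod (s := (Finset.univ : Finset (Fin (m + 1))))
      (f := fun _ => 1 + b) (g := fun j => F (Fin.succ (Fin.succ 0)) j.succ.succ.succ)
      (fun _ _ => by linarith) (fun j _ => hlow _ _
        (Fin.succ_lt_succ_iff.2 (Fin.succ_lt_succ_iff.2 j.succ_pos)))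
    simpa using this
  have rest : 1 ≤ ∏ i : Fin (m + 1), ∏ j ∈ Finset.Ioi i.succ.succ.succ, F i.succ.succ.succ j :=
    Finset.one_le_prod fun i _ =>
      Finset.one_le_prod fun j hj => hone _ _ (Finset.mem_Ioi.1 hj)
  rw [Fin.prod_univ_succ, Fin.prod_univ_succ, Fin.prod_univ_succ]
  have e1 : 1 + t ≤ (1 + t - a) * (1 + a) := by nlinarith
  have e2 : 1 + t ≤ (1 + t - b) * (1 + b) := by nlinarith
  have e3 : 1 + t ≤ (1 + t - b) * (1 + a) ^ (m + 1) :=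
    e2.trans (mul_le_mul_of_nonneg_left
      ((by linarith : 1 + b ≤ 1 + a).trans (le_self_pow₀ (by linarith) (by omega)))
      (by linarith))
  have ht : 0 ≤ 1 + t := by linarith
  have hta : 0 ≤ 1 + t - a := by linarith
  have htb : 0 ≤ 1 + t - b := by linarith
  have ha1 : 0 ≤ 1 + a := by linarith
  have hb1 : 0 ≤ 1 + b := by linarith
  calc (1 + t) ^ (2 * (m + 3))
      = (1 + t) ^ (m + 3) * ((1 + t) * (1 + t) * (1 + t) ^ (m + 1)) := by ring
    _ ≤ (1 + t) ^ (m + 3) * (((1 + t - a) * (1 + a)) * ((1 + t - b) * (1 + a) ^ (m + 1)) *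
          ((1 + t - b) * (1 + b)) ^ (m + 1)) := by gcongr
    _ = ((1 + t) * (1 + t - a) * ((1 + t) * (1 + t - b)) ^ (m + 2)) *
          ((1 + a) ^ (m + 2) * ((1 + b) ^ (m + 1) * 1)) := by
        simp only [mul_pow]; ring
    _ ≤ _ := by
        have r1 := (pow_nonneg ha1 (m + 2)).trans row1
        have r2 := (pow_nonneg hb1 (m + 1)).trans row2
        have r0 : 0 ≤ (1 + t) * (1 + t - a) * ((1 + t) * (1 + t - b)) ^ (m + 2) := by positivity
        exact mul_le_mul row0 (mul_le_mul row1 (mul_le_mul row2 rest zero_le_one r2)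
          (by positivity) r1) (by positivity) (r0.trans row0)

/-- key product lower bound for type `D_n` (`n ≥ 4`): for `λ` with
`λ_1 ≥ ⋯ ≥ λ_{n−1} ≥ |λ_n|` and `‖λ‖ ≥ 1`,
`∏_{i<j} (1+λ_i−λ_j)(1+λ_i+λ_j) ≥ c ‖λ‖^{2(n−1)}`. -/
theorem stmt_2 (n : ℕ) (hn : 4 ≤ n) :
    ∃ c : ℝ, 0 < c ∧ ∀ l : EuclideanSpace ℝ (Fin n),
      (∀ i j : Fin n, i ≤ j → (j : ℕ) < n - 1 → l j ≤ l i) →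
      |l ⟨n - 1, by omega⟩| ≤ l ⟨n - 2, by omega⟩ →
      1 ≤ ‖l‖ →
      c * ‖l‖ ^ (2 * (n - 1)) ≤
        ∏ i : Fin n, ∏ j ∈ Finset.Ioi i, (1 + l i - l j) * (1 + l i + l j) := by
  obtain ⟨m, rfl⟩ : ∃ m, n = m + 4 := ⟨n - 4, by omega⟩
  have hN : (0 : ℝ) < ((m + 4 : ℕ) : ℝ) ^ (m + 3) := by positivity
  refine ⟨(((m + 4 : ℕ) : ℝ) ^ (m + 3))⁻¹, inv_pos.2 hN, fun l hmono hlast _ => ?_⟩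
  have hnn : 0 ≤ l ⟨m + 4 - 2, by omega⟩ := (abs_nonneg _).trans hlast
  have H : ∀ i j : Fin (m + 4), i < j → |l j| ≤ l i := by
    intro i j hij
    have hij' : (i : ℕ) < j := hij
    by_cases hj : (j : ℕ) < m + 4 - 1
    · have h1 : l ⟨m + 4 - 2, by omega⟩ ≤ l j :=
        hmono _ _ (Fin.le_def.2 (by simp only; omega)) (by simp only; omega)
      rw [abs_of_nonneg (hnn.trans h1)]
      exact hmono _ _ hij.le hj
    · have hj' : j = ⟨m + 4 - 1, by omega⟩ := Fin.ext (by simp only; omega)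
      rw [hj']
      exact hlast.trans
        (hmono _ _ (Fin.le_def.2 (by simp only; omega)) (by simp only; omega))
  have h0 : 0 ≤ l 0 := (abs_nonneg _).trans (H 0 (Fin.succ 0) (Fin.succ_pos 0))
  have hnorm : ‖l‖ ^ 2 ≤ ((m + 4 : ℕ) : ℝ) * l 0 ^ 2 := by
    rw [EuclideanSpace.real_norm_sq_eq]
    have := Finset.sum_le_card_nsmul Finset.univ (fun i => l i ^ 2) (l 0 ^ 2) (fun i _ => by
      rcases Fin.eq_zero_or_eq_succ i with rfl | ⟨k, rfl⟩
      · exact le_rfl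
      · exact sq_le_sq' (by linarith [neg_abs_le (l k.succ), H 0 k.succ k.succ_pos])
          ((le_abs_self _).trans (H 0 k.succ k.succ_pos)))
    simpa using this
  refine le_trans ?_ (pow_le_prod_roots m l H)
  rw [inv_mul_le_iff₀ hN]
  calc ‖l‖ ^ (2 * (m + 4 - 1)) = (‖l‖ ^ 2) ^ (m + 3) := by rw [← pow_mul]; rfl
    _ ≤ (((m + 4 : ℕ) : ℝ) * l 0 ^ 2) ^ (m + 3) := by gcongr
    _ = ((m + 4 : ℕ) : ℝ) ^ (m + 3) * l 0 ^ (2 * (m + 3)) := by rw [mul_pow, ← pow_mul]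
    _ ≤ _ := by gcongr; linarith
end

section
/- Let n ≥ 2 and let λ_1 ≥ λ_2 ≥ ⋯ ≥ λ_{n+1} be real numbers, and set g = max_{1 ≤ k ≤ n}(λ_k − λ_{k+1}). If the maximum g is attained at some index m with 2 ≤ m ≤ n−1, or if it is attained at both index 1 and index n, then the number of pairs (i,j) with 1 ≤ i < j ≤ n+1 and λ_i − λ_j ≥ g is at least n+1. -/
/-- let `λ_1 ≥ ⋯ ≥ λ_{n+1}` (`n ≥ 2`) and let `g` be the largest
successive gap. If `g` is attained at an interior index `m` (`2 ≤ m ≤ n−1` in 1-based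
indexing), or attained at both index `1` and index `n`, then at least `n+1` pairs
`(i,j)`, `i < j`, satisfy `λ_i − λ_j ≥ g`.  (Here gaps are indexed by `k : Fin n`,
the `k`-th gap being `l k.castSucc - l k.succ`; index 1 is `k = 0` and index `n` is
`k = ⟨n-1,_⟩`.) -/
theorem stmt_4 (n : ℕ) (hn : 2 ≤ n) (l : Fin (n + 1) → ℝ)
    (hmono : ∀ i j : Fin (n + 1), i ≤ j → l j ≤ l i)
    (g : ℝ)
    (hub : ∀ k : Fin n, l k.castSucc - l k.succ ≤ g)
    (hmem : ∃ k : Fin n, l k.castSucc - l k.succ = g)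
    (hattain :
      (∃ m : Fin n, 0 < (m : ℕ) ∧ (m : ℕ) < n - 1 ∧ l m.castSucc - l m.succ = g) ∨
      (l (⟨0, by omega⟩ : Fin n).castSucc - l (⟨0, by omega⟩ : Fin n).succ = g ∧
        l (⟨n - 1, by omega⟩ : Fin n).castSucc - l (⟨n - 1, by omega⟩ : Fin n).succ = g)) :
    n + 1 ≤ (Finset.univ.filter
      (fun p : Fin (n + 1) × Fin (n + 1) => p.1 < p.2 ∧ g ≤ l p.1 - l p.2)).card := by
  rcases hattain with ⟨m, hm0, hmn, hm⟩ | ⟨h0, h1⟩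
  · have hsub : Finset.Iic m.castSucc ×ˢ Finset.Ici m.succ ⊆ Finset.univ.filter
        (fun p : Fin (n + 1) × Fin (n + 1) => p.1 < p.2 ∧ g ≤ l p.1 - l p.2) := by
      rintro ⟨i, j⟩ hp
      simp only [Finset.mem_product, Finset.mem_Iic, Finset.mem_Ici] at hp
      simp only [Finset.mem_filter, Finset.mem_univ, true_and]
      refine ⟨hp.1.trans_lt (Fin.castSucc_lt_succ.trans_le hp.2), ?_⟩
      linarith [hmono _ _ hp.1, hmono _ _ hp.2]
    refine le_trans ?_ (Finset.card_le_card hsub)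
    rw [Finset.card_product, Fin.card_Iic, Fin.card_Ici, Fin.val_castSucc, Fin.val_succ]
    obtain ⟨a, ha⟩ : ∃ a, (m : ℕ) = a + 1 := ⟨m - 1, by omega⟩
    obtain ⟨b, hb⟩ : ∃ b, n = a + b + 3 := ⟨n - a - 3, by omega⟩
    have hsize : n + 1 - ((m : ℕ) + 1) = b + 2 := by omega
    rw [hsize, ha, hb]
    nlinarith [Nat.zero_le (a * b)]
  · let q : Fin (n + 1) × Fin (n + 1) :=
      ((⟨n - 1, by omega⟩ : Fin n).castSucc, (⟨n - 1, by omega⟩ : Fin n).succ)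
    let s : Finset (Fin (n + 1) × Fin (n + 1)) :=
      Finset.univ.image (fun k : Fin n => ((0 : Fin (n + 1)), k.succ))
    have hcard : s.card = n := by
      rw [Finset.card_image_of_injective _ (fun a b hab => Fin.succ_injective _
        (congrArg Prod.snd hab)), Finset.card_univ, Fintype.card_fin]
    have hq : q ∉ s := by
      intro h
      obtain ⟨k, -, hk⟩ := Finset.mem_image.mp h
      have := congrArg (fun p => (p.1 : ℕ)) hk
      simp only [q, Fin.val_zero, Fin.val_castSucc] at this
      omega
    have hins : (insert q s).card = n + 1 := by rw [Finset.card_insert_of_notMem hq, hcard]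
    refine hins.ge.trans (Finset.card_le_card fun p hp => ?_)
    simp only [Finset.mem_filter, Finset.mem_univ, true_and]
    rcases Finset.mem_insert.mp hp with rfl | hp
    · exact ⟨Fin.castSucc_lt_succ, h1.ge⟩
    · obtain ⟨k, -, rfl⟩ := Finset.mem_image.mp hp
      refine ⟨Fin.succ_pos k, ?_⟩
      have hle : l k.succ ≤ l (⟨0, by omega⟩ : Fin n).succ :=
        hmono _ _ (Fin.succ_le_succ_iff.mpr (Nat.zero_le _))
      have hzero : (⟨0, by omega⟩ : Fin n).castSucc = (0 : Fin (n + 1)) := rfl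
      rw [hzero] at h0
      change g ≤ l 0 - l k.succ
      linarith
end

section
/- Let n ≥ 2 and let λ_1 ≥ λ_2 ≥ ⋯ ≥ λ_{n+1} be real numbers with gaps g_k = λ_k − λ_{k+1} for 1 ≤ k ≤ n. Suppose the maximum of the g_k is attained at m = 1 or at m = n, and let g' = max_{k ≠ m} g_k. Then the number of pairs (i,j) with 1 ≤ i < j ≤ n+1 and λ_i − λ_j ≥ g' is at least 2n − 1. -/
/-- A gap of a non-increasing sequence is at most any difference spanning it. -/
theorem gap_le_sub_of_spans {n : ℕ} {l : Fin (n + 1) → ℝ}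
    (hmono : ∀ i j : Fin (n + 1), i ≤ j → l j ≤ l i) (k : Fin n) {i j : Fin (n + 1)}
    (hi : i ≤ k.castSucc) (hj : k.succ ≤ j) :
    l k.castSucc - l k.succ ≤ l i - l j := by
  linarith [hmono _ _ hi, hmono _ _ hj]

/-- The ordered pairs of distinct indices containing `e`, together with a hook of ordered
pairs avoiding `e` around the step from `k` to `k + 1`, number `2n - 1`. -/
theorem two_mul_sub_one_le_card_of_hook {n : ℕ} (k : Fin n) (e : Fin (n + 1))
    (hk : e ≠ k.castSucc) (hk' : e ≠ k.succ) (S : Finset (Fin (n + 1) × Fin (n + 1)))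
    (hS : ∀ t, t ≠ e → (min e t, max e t) ∈ S)
    (hle : ∀ t, t ≠ e → t ≤ k.castSucc → (t, k.succ) ∈ S)
    (hlt : ∀ t, t ≠ e → k.succ < t → (k.castSucc, t) ∈ S) :
    2 * n - 1 ≤ S.card := by
  classical
  let f : Fin (n + 1) → Fin (n + 1) × Fin (n + 1) := fun t => (min e t, max e t)
  let g : Fin (n + 1) → Fin (n + 1) × Fin (n + 1) := fun t =>
    if t ≤ k.castSucc then (t, k.succ) else (k.castSucc, t)
  let A : Finset (Fin (n + 1)) := Finset.univ.erase e
  let B : Finset (Fin (n + 1)) := A.erase k.succ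
  have hA : A.card = n := by simp [A]
  have hB : B.card = n - 1 := by
    rw [Finset.card_erase_of_mem (by simp [A, hk'.symm]), hA]
  have hf : Set.InjOn f A := by
    intro s hs t ht h
    simp only [f, Prod.mk.injEq] at h
    grind
  have hg : Set.InjOn g B := by
    intro s hs t ht h
    have hs' : s ≠ k.succ := by simp_all [B]
    have ht' : t ≠ k.succ := by simp_all [B]
    simp only [g] at h
    split_ifs at h <;> simp_all
  have hdisj : Disjoint (A.image f) (B.image g) := by
    rw [Finset.disjoint_left]
    intro p hp hq
    obtain ⟨s, hs, rfl⟩ := Finset.mem_image.mp hp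
    obtain ⟨t, ht, h⟩ := Finset.mem_image.mp hq
    have hte : t ≠ e := by simp_all [A, B]
    simp only [f, g] at h
    split_ifs at h <;> simp only [Prod.mk.injEq] at h <;> grind
  have hsub : A.image f ∪ B.image g ⊆ S := by
    intro p hp
    rcases Finset.mem_union.mp hp with hp | hp
    · obtain ⟨t, ht, rfl⟩ := Finset.mem_image.mp hp
      exact hS t (Finset.ne_of_mem_erase ht)
    · obtain ⟨t, ht, rfl⟩ := Finset.mem_image.mp hp
      have hte : t ≠ e := Finset.ne_of_mem_erase (Finset.mem_of_mem_erase ht)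
      have htk : t ≠ k.succ := Finset.ne_of_mem_erase ht
      simp only [g]
      split_ifs with h
      · exact hle t hte h
      · refine hlt t hte (lt_of_le_of_ne ?_ htk.symm)
        simpa [Fin.castSucc_lt_iff_succ_le] using h
  have := Finset.card_le_card hsub
  rw [Finset.card_union_of_disjoint hdisj, Finset.card_image_of_injOn hf,
    Finset.card_image_of_injOn hg, hA, hB] at this
  omega


/-- let `λ_1 ≥ ⋯ ≥ λ_{n+1}` (`n ≥ 2`) with gaps `g_k = λ_k − λ_{k+1}`.
Suppose the maximal gap is attained at `m = 1` or `m = n` (0-based: `m = 0` or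
`m = n−1`), and let `g'` be the maximum of the gaps `g_k`, `k ≠ m`. Then at least
`2n − 1` pairs `(i,j)`, `i < j`, satisfy `λ_i − λ_j ≥ g'`. -/
theorem stmt_5 (n : ℕ) (hn : 2 ≤ n) (l : Fin (n + 1) → ℝ)
    (hmono : ∀ i j : Fin (n + 1), i ≤ j → l j ≤ l i)
    (m : Fin n) (hm : (m : ℕ) = 0 ∨ (m : ℕ) = n - 1)
    (hmax : ∀ k : Fin n, l k.castSucc - l k.succ ≤ l m.castSucc - l m.succ)
    (g' : ℝ)
    (hub : ∀ k : Fin n, k ≠ m → l k.castSucc - l k.succ ≤ g')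
    (hmem : ∃ k : Fin n, k ≠ m ∧ l k.castSucc - l k.succ = g') :
    2 * n - 1 ≤ (Finset.univ.filter
      (fun p : Fin (n + 1) × Fin (n + 1) => p.1 < p.2 ∧ g' ≤ l p.1 - l p.2)).card := by
  obtain ⟨k, hkm, rfl⟩ := hmem
  have hkm' : (k : ℕ) ≠ m := fun h => hkm (Fin.ext h)
  have hspan : ∀ i j, i ≤ k.castSucc → k.succ ≤ j → (i, j) ∈ Finset.univ.filter
      (fun p : Fin (n + 1) × Fin (n + 1) =>
        p.1 < p.2 ∧ l k.castSucc - l k.succ ≤ l p.1 - l p.2) := by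
    intro i j hi hj
    simp only [Finset.mem_filter, Finset.mem_univ, true_and]
    exact ⟨hi.trans_lt (k.castSucc_lt_succ.trans_le hj), gap_le_sub_of_spans hmono k hi hj⟩
  have hspan' : ∀ i j, i ≤ m.castSucc → m.succ ≤ j → (i, j) ∈ Finset.univ.filter
      (fun p : Fin (n + 1) × Fin (n + 1) =>
        p.1 < p.2 ∧ l k.castSucc - l k.succ ≤ l p.1 - l p.2) := by
    intro i j hi hj
    simp only [Finset.mem_filter, Finset.mem_univ, true_and]
    exact ⟨hi.trans_lt (m.castSucc_lt_succ.trans_le hj),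
      (hmax k).trans (gap_le_sub_of_spans hmono m hi hj)⟩
  have hk := k.isLt
  rcases hm with hm | hm
  · refine two_mul_sub_one_le_card_of_hook k 0 ?_ ?_ _ (fun t ht => ?_)
      (fun t _ h => hspan _ _ h le_rfl) (fun t _ h => hspan _ _ le_rfl h.le)
    · simp only [ne_eq, Fin.ext_iff, Fin.val_zero, Fin.val_castSucc]
      omega
    · exact (Fin.succ_ne_zero k).symm
    · rw [min_eq_left (Fin.zero_le t), max_eq_right (Fin.zero_le t)]
      refine hspan' _ _ (Fin.zero_le _) ?_
      simp only [ne_eq, Fin.ext_iff, Fin.val_zero, Fin.le_def, Fin.val_succ] at ht ⊢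
      omega
  · refine two_mul_sub_one_le_card_of_hook k (Fin.last n) ?_ ?_ _ (fun t ht => ?_)
      (fun t _ h => hspan _ _ h le_rfl) (fun t _ h => hspan _ _ le_rfl h.le)
    · exact (Fin.castSucc_ne_last k).symm
    · simp only [ne_eq, Fin.ext_iff, Fin.val_last, Fin.val_succ]
      omega
    · rw [min_eq_right (Fin.le_last t), max_eq_left (Fin.le_last t)]
      refine hspan' _ _ ?_ (Fin.le_last _)
      have := t.isLt
      simp only [ne_eq, Fin.ext_iff, Fin.val_last, Fin.le_def, Fin.val_castSucc] at ht ⊢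
      omega
end

section
/- Let n ≥ 2 and let a_1 ≥ a_2 ≥ ⋯ ≥ a_n ≥ 0 be real numbers with a_1 > 0. Let N = #{(i,j,s) : 1 ≤ i < j ≤ n, s ∈ {+1,−1}, a_i + s·a_j ≥ a_1/2} and M = #{i : 1 ≤ i ≤ n, a_i ≥ a_1/2}. Then either N ≥ 2(n−1) and M ≥ 1, or N ≥ 2n−3 and M ≥ 2. In particular, for any reals η_0, η ≥ 0 one has η_0·N + η·M ≥ η_0(2n−3) + η. -/
/-- let `a_1 ≥ ⋯ ≥ a_n ≥ 0` (`n ≥ 2`) with `a_1 > 0`. Let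
`N = #{(i,j,s) : i < j, s = ±1, a_i + s·a_j ≥ a_1/2}` (counted as the sum of the
`+` and `−` sign counts) and `M = #{i : a_i ≥ a_1/2}`. Then either `N ≥ 2(n−1)` and
`M ≥ 1`, or `N ≥ 2n−3` and `M ≥ 2`; in particular `η₀N + ηM ≥ η₀(2n−3) + η` for all
reals `η₀, η ≥ 0`. -/
theorem stmt_6 (n : ℕ) (hn : 2 ≤ n) (a : Fin n → ℝ)
    (hmono : ∀ i j : Fin n, i ≤ j → a j ≤ a i)
    (hnonneg : ∀ i, 0 ≤ a i)
    (hpos : 0 < a ⟨0, by omega⟩)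
    (N M : ℕ)
    (hN : N = (Finset.univ.filter
          (fun p : Fin n × Fin n => p.1 < p.2 ∧ a ⟨0, by omega⟩ / 2 ≤ a p.1 + a p.2)).card
        + (Finset.univ.filter
          (fun p : Fin n × Fin n => p.1 < p.2 ∧ a ⟨0, by omega⟩ / 2 ≤ a p.1 - a p.2)).card)
    (hM : M = (Finset.univ.filter (fun i : Fin n => a ⟨0, by omega⟩ / 2 ≤ a i)).card) :
    ((2 * (n - 1) ≤ N ∧ 1 ≤ M) ∨ (2 * n - 3 ≤ N ∧ 2 ≤ M)) ∧
      ∀ η₀ η : ℝ, 0 ≤ η₀ → 0 ≤ η →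
        η₀ * (2 * (n : ℝ) - 3) + η ≤ η₀ * N + η * M := by
  have hcount : (2 * (n - 1) ≤ N ∧ 1 ≤ M) ∨ (2 * n - 3 ≤ N ∧ 2 ≤ M) := by
    set z : Fin n := ⟨0, by omega⟩ with hz
    set w : Fin n := ⟨1, by omega⟩ with hw
    have hzw : z ≠ w := by simp [hz, hw]
    have hz_card : (({z} : Finset (Fin n)) ×ˢ Finset.Ioi z).card = n - 1 := by simp [hz]
    have hw_card : (({w} : Finset (Fin n)) ×ˢ Finset.Ioi w).card = n - 1 - 1 := by simp [hw]
    rcases le_or_gt (a w) (a z / 2) with h | h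
    · left
      constructor
      · have hplus : ({z} : Finset (Fin n)) ×ˢ Finset.Ioi z ⊆ Finset.univ.filter
            (fun p : Fin n × Fin n => p.1 < p.2 ∧ a z / 2 ≤ a p.1 + a p.2) := by
          rintro ⟨i, j⟩ hij
          simp only [Finset.mem_product, Finset.mem_singleton, Finset.mem_Ioi] at hij
          obtain ⟨rfl, hj⟩ := hij
          simp only [Finset.mem_filter_univ]
          exact ⟨hj, by linarith [hnonneg j]⟩
        have hminus : ({z} : Finset (Fin n)) ×ˢ Finset.Ioi z ⊆ Finset.univ.filter
            (fun p : Fin n × Fin n => p.1 < p.2 ∧ a z / 2 ≤ a p.1 - a p.2) := by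
          rintro ⟨i, j⟩ hij
          simp only [Finset.mem_product, Finset.mem_singleton, Finset.mem_Ioi] at hij
          obtain ⟨rfl, hj⟩ := hij
          simp only [Finset.mem_filter_univ]
          have hwj : w ≤ j := Nat.succ_le_of_lt hj
          exact ⟨hj, by linarith [hmono w j hwj]⟩
        have := Finset.card_le_card hplus
        have := Finset.card_le_card hminus
        omega
      · rw [hM, Nat.succ_le_iff, Finset.card_pos]
        exact ⟨z, by simp only [Finset.mem_filter_univ]; linarith⟩
    · right
      constructor
      · have hplus : ({z} : Finset (Fin n)) ×ˢ Finset.Ioi z ∪ {w} ×ˢ Finset.Ioi w ⊆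
            Finset.univ.filter
              (fun p : Fin n × Fin n => p.1 < p.2 ∧ a z / 2 ≤ a p.1 + a p.2) := by
          rintro ⟨i, j⟩ hij
          simp only [Finset.mem_union, Finset.mem_product, Finset.mem_singleton,
            Finset.mem_Ioi] at hij
          simp only [Finset.mem_filter_univ]
          rcases hij with ⟨rfl, hj⟩ | ⟨rfl, hj⟩ <;> exact ⟨hj, by linarith [hnonneg j]⟩
        have hdisj : Disjoint (({z} : Finset (Fin n)) ×ˢ Finset.Ioi z) ({w} ×ˢ Finset.Ioi w) :=
          Finset.disjoint_product.2 (Or.inl (Finset.disjoint_singleton.2 hzw))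
        have := Finset.card_le_card hplus
        rw [Finset.card_union_of_disjoint hdisj] at this
        omega
      · rw [hM, ← Finset.card_pair hzw]
        refine Finset.card_le_card fun i hi => ?_
        simp only [Finset.mem_insert, Finset.mem_singleton] at hi
        simp only [Finset.mem_filter_univ]
        rcases hi with rfl | rfl <;> linarith
  refine ⟨hcount, fun η₀ η hη₀ hη => ?_⟩
  have hN_nat : 2 * n ≤ N + 3 := by omega
  have hN_real : 2 * (n : ℝ) - 3 ≤ N := by
    have : 2 * (n : ℝ) ≤ N + 3 := by exact_mod_cast hN_nat
    linarith
  have hM_real : (1 : ℝ) ≤ M := by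
    have : 1 ≤ M := by omega
    exact_mod_cast this
  exact add_le_add (mul_le_mul_of_nonneg_left hN_real hη₀) (le_mul_of_one_le_right hη hM_real)
end

section
/- Let n ≥ 4 and let λ = (λ_1,…,λ_n) ∈ ℝ^n satisfy λ_1 ≥ λ_2 ≥ ⋯ ≥ λ_{n−1} ≥ |λ_n|. Set g = max( max_{1 ≤ i ≤ n−1}(λ_i − λ_{i+1}), λ_{n−1} + λ_n ). Then the number of pairs (i,j,s) with 1 ≤ i < j ≤ n, s ∈ {+1,−1} and λ_i + s·λ_j ≥ g is at least 2(n−1). -/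
/-- A lower bound on a number of pairs `i < j` in `Fin n`, from an injective enumeration
`k ↦ (u k, v k)` by natural numbers. -/
theorem le_card_filter_lt_of_injective {n m : ℕ} (P : Fin n → Fin n → Prop)
    [DecidablePred fun p : Fin n × Fin n => p.1 < p.2 ∧ P p.1 p.2] (u v : ℕ → ℕ)
    (huv : ∀ k < m, u k < v k ∧ v k < n)
    (hinj : ∀ k < m, ∀ k' < m, u k = u k' → v k = v k' → k = k')
    (hP : ∀ k < m, ∀ i j : Fin n, (i : ℕ) = u k → (j : ℕ) = v k → P i j) :
    m ≤ (Finset.univ.filter (fun p : Fin n × Fin n => p.1 < p.2 ∧ P p.1 p.2)).card := by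
  let f : Fin m → Fin n × Fin n := fun k =>
    (⟨u k, (huv k k.2).1.trans (huv k k.2).2⟩, ⟨v k, (huv k k.2).2⟩)
  have hf : Function.Injective f := by
    intro k k' h
    simp only [f, Prod.mk.injEq, Fin.mk.injEq] at h
    exact Fin.ext (hinj k k.2 k' k'.2 h.1 h.2)
  calc m = (Finset.univ.image f).card := by
        rw [Finset.card_image_of_injective _ hf, Finset.card_fin]
    _ ≤ _ := by
      refine Finset.card_le_card fun p hp => ?_
      obtain ⟨k, -, rfl⟩ := Finset.mem_image.1 hp
      exact Finset.mem_filter.2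
        ⟨Finset.mem_univ _, (huv k k.2).1, hP k k.2 _ _ rfl rfl⟩


/-- type `D_n` count (`n ≥ 4`): for `λ` with `λ_1 ≥ ⋯ ≥ λ_{n−1} ≥ |λ_n|`
and `g = max(max_i (λ_i − λ_{i+1}), λ_{n−1} + λ_n)`, at least `2(n−1)` triples
`(i,j,s)` with `i < j`, `s = ±1`, satisfy `λ_i + s·λ_j ≥ g` (counted as the sum of the
`+` and `−` sign counts). -/
theorem stmt_7 (n : ℕ) (hn : 4 ≤ n) (l : Fin n → ℝ)
    (hmono : ∀ i j : Fin n, i ≤ j → (j : ℕ) < n - 1 → l j ≤ l i)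
    (hlast : |l ⟨n - 1, by omega⟩| ≤ l ⟨n - 2, by omega⟩)
    (g : ℝ)
    (hub1 : ∀ i j : Fin n, (i : ℕ) + 1 = (j : ℕ) → l i - l j ≤ g)
    (hub2 : l ⟨n - 2, by omega⟩ + l ⟨n - 1, by omega⟩ ≤ g)
    (hmem : (∃ i j : Fin n, (i : ℕ) + 1 = (j : ℕ) ∧ l i - l j = g) ∨
        l ⟨n - 2, by omega⟩ + l ⟨n - 1, by omega⟩ = g) :
    2 * (n - 1) ≤
      (Finset.univ.filter
        (fun p : Fin n × Fin n => p.1 < p.2 ∧ g ≤ l p.1 + l p.2)).card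
      + (Finset.univ.filter
        (fun p : Fin n × Fin n => p.1 < p.2 ∧ g ≤ l p.1 - l p.2)).card := by
  have hlast' := abs_le.1 hlast
  set p : Fin n := ⟨n - 2, by omega⟩ with hp
  set q : Fin n := ⟨n - 1, by omega⟩ with hq
  have hpv : (p : ℕ) = n - 2 := rfl
  have hqv : (q : ℕ) = n - 1 := rfl
  have hge : ∀ i : Fin n, (i : ℕ) < n - 1 → l p ≤ l i := fun i hi =>
    hmono i p (Fin.le_def.2 (by omega)) (by omega)
  have hanti : ∀ i j : Fin n, (i : ℕ) ≤ j → (i : ℕ) < n - 1 → l j ≤ l i := by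
    intro i j hij hi
    by_cases hj : (j : ℕ) < n - 1
    · exact hmono i j hij hj
    · have : j = q := Fin.ext (by omega)
      subst this
      linarith [hge i hi]
  have hneg : ∀ i j : Fin n, (i : ℕ) ≤ j → (i : ℕ) < n - 1 → -l j ≤ l i := by
    intro i j hij hi
    by_cases hj : (j : ℕ) < n - 1
    · linarith [hge i hi, hge j hj]
    · have : j = q := Fin.ext (by omega)
      subst this
      linarith [hge i hi]
  rcases hmem with ⟨a, b, hab, hg⟩ | hg
  · by_cases hb : (b : ℕ) < n - 1
    · have hplus := le_card_filter_lt_of_injective (m := n - 1) (fun i j => g ≤ l i + l j)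
        (fun k => if k < a then k else a) (fun k => if k < a then a else k + 1)
        (by intro k hk; split_ifs <;> omega)
        (by intro k hk k' hk'; split_ifs <;> omega)
        (by
          intro k hk i j hi hj
          split_ifs at hi hj with h
          · obtain rfl : j = a := Fin.ext hj
            linarith [hanti i j (by omega) (by omega), hge i (by omega), hge b hb]
          · obtain rfl : i = a := Fin.ext hi
            linarith [hneg b j (by omega) hb])
      have hminus := le_card_filter_lt_of_injective (m := n - 1) (fun i j => g ≤ l i - l j)
        (fun k => if k < a then k else a) (fun k => if k < a then b else k + 1)
        (by intro k hk; split_ifs <;> omega)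
        (by intro k hk k' hk'; split_ifs <;> omega)
        (by
          intro k hk i j hi hj
          split_ifs at hi hj with h
          · obtain rfl : j = b := Fin.ext hj
            linarith [hanti i a (by omega) (by omega)]
          · obtain rfl : i = a := Fin.ext hi
            linarith [hanti b j (by omega) hb])
      omega
    · obtain rfl : b = q := Fin.ext (by omega)
      obtain rfl : a = p := Fin.ext (by omega)
      have hplus := le_card_filter_lt_of_injective (m := n - 1) (fun i j => g ≤ l i + l j)
        (fun k => if k < n - 2 then k else 0) (fun k => if k < n - 2 then k + 1 else n - 2)
        (by intro k hk; split_ifs <;> omega)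
        (by intro k hk k' hk'; split_ifs <;> omega)
        (by
          intro k hk i j hi hj
          have hi' : (i : ℕ) < n - 1 := by split_ifs at hi <;> omega
          have hj' : (j : ℕ) < n - 1 := by split_ifs at hj <;> omega
          linarith [hge i hi', hge j hj'])
      have hminus := le_card_filter_lt_of_injective (m := n - 1) (fun i j => g ≤ l i - l j)
        (fun k => k) (fun _ => n - 1)
        (by intro k hk; omega)
        (by intro k hk k' hk' h _; exact h)
        (by
          intro k hk i j hi hj
          obtain rfl : j = q := Fin.ext hj
          linarith [hge i (by omega)])
      omega
  · have hplus := le_card_filter_lt_of_injective (m := 2 * (n - 1)) (fun i j => g ≤ l i + l j)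
      (fun k => if k < n - 1 then k else if k < 2 * n - 3 then k - (n - 1) else 0)
      (fun k => if k < n - 1 then n - 1 else if k < 2 * n - 3 then k - (n - 1) + 1 else n - 2)
      (by intro k hk; split_ifs <;> omega)
      (by intro k hk k' hk'; split_ifs <;> omega)
      (by
        intro k hk i j hi hj
        by_cases h : k < n - 1
        · rw [if_pos h] at hi hj
          obtain rfl : j = q := Fin.ext hj
          linarith [hge i (by omega)]
        · rw [if_neg h] at hi hj
          have hi' : (i : ℕ) < n - 1 := by split_ifs at hi <;> omega
          have hj' : (j : ℕ) < n - 1 := by split_ifs at hj <;> omega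
          linarith [hge i hi', hge j hj'])
    omega
end

section
/- For every integer n ≥ 2, the integral over [0,∞)^n of the function (a_1,…,a_n) ↦ ∏_{1 ≤ i ≤ j ≤ n} (1 + a_i + a_{i+1} + ⋯ + a_j)^{−1} with respect to Lebesgue measure is finite. -/
open MeasureTheory

theorem sqrt_mul_sqrt_le_one_add_sum_Icc {ι : Type*} [PartialOrder ι] [LocallyFiniteOrder ι]
    {a : ι → ℝ} (ha : ∀ i, 0 ≤ a i) {i j : ι} (hij : i ≤ j) :
    √(1 + a i) * √(1 + a j) ≤ 1 + ∑ k ∈ Finset.Icc i j, a k := by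
  have hi : a i ≤ ∑ k ∈ Finset.Icc i j, a k :=
    Finset.single_le_sum (fun k _ => ha k) (Finset.left_mem_Icc.2 hij)
  have hj : a j ≤ ∑ k ∈ Finset.Icc i j, a k :=
    Finset.single_le_sum (fun k _ => ha k) (Finset.right_mem_Icc.2 hij)
  have hs : 0 ≤ 1 + ∑ k ∈ Finset.Icc i j, a k := by linarith [ha i]
  calc √(1 + a i) * √(1 + a j)
      ≤ √(1 + ∑ k ∈ Finset.Icc i j, a k) * √(1 + ∑ k ∈ Finset.Icc i j, a k) := by gcongr
    _ = _ := Real.mul_self_sqrt hs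

theorem prod_prod_Ici_mul {M : Type*} [CommMonoid M] {n : ℕ} (f : Fin n → M) :
    ∏ i : Fin n, ∏ j ∈ Finset.Ici i, f i * f j = ∏ i : Fin n, f i ^ (n + 1) := by
  have hswap : ∏ i : Fin n, ∏ j ∈ Finset.Ici i, f j = ∏ j : Fin n, ∏ _i ∈ Finset.Iic j, f j :=
    Finset.prod_comm' (by simp)
  simp only [Finset.prod_mul_distrib, hswap, Finset.prod_const, Fin.card_Ici, Fin.card_Iic]
  rw [← Finset.prod_mul_distrib]
  refine Finset.prod_congr rfl fun i _ => ?_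
  rw [← pow_add]
  congr 1
  omega

theorem prod_inv_one_add_sum_Icc_le {n : ℕ} {a : Fin n → ℝ} (ha : ∀ i, 0 ≤ a i) :
    ∏ i : Fin n, ∏ j ∈ Finset.Ici i, (1 + ∑ k ∈ Finset.Icc i j, a k)⁻¹ ≤
      ∏ i : Fin n, (1 + a i) ^ (-((n + 1 : ℝ) / 2)) := by
  have hpos : ∀ i, 0 < 1 + a i := fun i => by linarith [ha i]
  calc ∏ i : Fin n, ∏ j ∈ Finset.Ici i, (1 + ∑ k ∈ Finset.Icc i j, a k)⁻¹
      ≤ ∏ i : Fin n, ∏ j ∈ Finset.Ici i, ((√(1 + a i))⁻¹ * (√(1 + a j))⁻¹) := by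
        have h0 : ∀ i j, 0 ≤ (1 + ∑ k ∈ Finset.Icc i j, a k)⁻¹ := fun i j =>
          inv_nonneg.2 (add_nonneg zero_le_one (Finset.sum_nonneg fun k _ => ha k))
        refine Finset.prod_le_prod (fun i _ => Finset.prod_nonneg fun j _ => h0 i j) fun i _ =>
          Finset.prod_le_prod (fun j _ => h0 i j) fun j hj => ?_
        rw [← mul_inv]
        exact inv_anti₀ (mul_pos (Real.sqrt_pos.2 (hpos i)) (Real.sqrt_pos.2 (hpos j)))
          (sqrt_mul_sqrt_le_one_add_sum_Icc ha (Finset.mem_Ici.1 hj))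
    _ = ∏ i : Fin n, (√(1 + a i))⁻¹ ^ (n + 1) := prod_prod_Ici_mul fun i => (√(1 + a i))⁻¹
    _ = _ := by
        refine Finset.prod_congr rfl fun i _ => ?_
        rw [Real.sqrt_eq_rpow, ← Real.rpow_neg (hpos i).le, ← Real.rpow_mul_natCast (hpos i).le]
        congr 1
        push_cast
        ring

theorem integrableOn_Ici_one_add_rpow {s : ℝ} (hs : s < -1) :
    IntegrableOn (fun x : ℝ => (1 + x) ^ s) (Set.Ici 0) := by
  rw [integrableOn_Ici_iff_integrableOn_Ioi]
  simpa only [add_comm] using integrableOn_add_rpow_Ioi_of_lt hs (show -(1 : ℝ) < 0 by norm_num)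

/-- for `n ≥ 2`, the integral over `[0,∞)^n` of
`∏_{1 ≤ i ≤ j ≤ n} (1 + a_i + ⋯ + a_j)⁻¹` is finite. -/
theorem stmt_8 (n : ℕ) (hn : 2 ≤ n) :
    ∫⁻ a in {a : Fin n → ℝ | ∀ i, 0 ≤ a i},
      ENNReal.ofReal
        (∏ i : Fin n, ∏ j ∈ Finset.Ici i, (1 + ∑ k ∈ Finset.Icc i j, a k)⁻¹) < ⊤ := by
  have hset : {a : Fin n → ℝ | ∀ i, 0 ≤ a i} = Set.univ.pi fun _ => Set.Ici 0 := by
    ext a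
    simp only [Set.mem_ofPred_eq, Set.mem_univ_pi, Set.mem_Ici]
  have hs : -((n + 1 : ℝ) / 2) < -1 := by
    have : (2 : ℝ) ≤ n := by exact_mod_cast hn
    linarith
  have hint : IntegrableOn (fun a : Fin n → ℝ => ∏ i, (1 + a i) ^ (-((n + 1 : ℝ) / 2)))
      (Set.univ.pi fun _ => Set.Ici 0) := by
    rw [IntegrableOn, volume_pi, Measure.restrict_pi_pi]
    exact Integrable.fintype_prod fun _ => integrableOn_Ici_one_add_rpow hs
  rw [hset]
  refine lt_of_le_of_lt (setLIntegral_mono' (MeasurableSet.univ_pi fun _ => measurableSet_Ici)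
    fun a ha => ENNReal.ofReal_le_ofReal (prod_inv_one_add_sum_Icc_le fun i => ?_))
    hint.lintegral_lt_top
  exact ha i (Set.mem_univ i)
end

section
/- Let n ≥ 2 and let η_0 ≥ 1 be an integer. Let a = (a_1,…,a_n) ∈ ℝ^n be a vector whose coordinates are not all equal. Then there exists a constant C > 0 such that for every integer k ≥ n−1 and every λ = (λ_1,…,λ_n) ∈ ℝ^n with λ_1 ≥ λ_2 ≥ ⋯ ≥ λ_n and λ_1 + ⋯ + λ_n = 0, one has ( ∏_{1 ≤ i < j ≤ n, a_i ≠ a_j} (1 + λ_i − λ_j)^{−η_0 k} ) · ∏_{1 ≤ i < j ≤ n} (1 + λ_i − λ_j)^{η_0} ≤ C · min(1, ‖λ‖^{−η_0(k−n+1)}), where ‖·‖ is the Euclidean norm. -/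
section SymmetricSums

variable {n : ℕ} {f : Fin n → Fin n → ℝ}

/-- Summing a symmetric function that vanishes on the diagonal over all ordered pairs counts
each pair `i < j` twice. -/
lemma sum_sum_eq_two_mul_sum_Ioi (hsymm : ∀ i j, f i j = f j i) (hdiag : ∀ i, f i i = 0) :
    ∑ i, ∑ j, f i j = 2 * ∑ i, ∑ j ∈ Finset.Ioi i, f i j := by
  have h := Finset.sum_sum_Ioi_add_eq_sum_sum_off_diag f
  have h1 : ∀ i, ∑ j ∈ ({i}ᶜ : Finset (Fin n)), f j i = ∑ j, f i j := by
    intro i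
    rw [← Finset.sum_add_sum_compl {i} (fun j => f i j)]
    simp [hdiag, hsymm i]
  rw [Finset.sum_congr rfl fun i _ => h1 i] at h
  rw [← h, Finset.mul_sum]
  refine Finset.sum_congr rfl fun i _ => ?_
  rw [Finset.mul_sum]
  refine Finset.sum_congr rfl fun j _ => ?_
  rw [hsymm j i]; ring

lemma sum_univ_sum_univ_eq_sum_blocks (hsymm : ∀ i j, f i j = f j i) (S : Finset (Fin n)) :
    ∑ i, ∑ j, f i j = ∑ i ∈ S, ∑ j ∈ S, f i j + ∑ i ∈ Sᶜ, ∑ j ∈ Sᶜ, f i j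
      + 2 * ∑ i ∈ S, ∑ j ∈ Sᶜ, f i j := by
  have h1 : ∀ i, ∑ j, f i j = ∑ j ∈ S, f i j + ∑ j ∈ Sᶜ, f i j := fun i =>
    (Finset.sum_add_sum_compl S _).symm
  have h2 : ∑ i ∈ Sᶜ, ∑ j ∈ S, f i j = ∑ i ∈ S, ∑ j ∈ Sᶜ, f i j := by
    rw [Finset.sum_comm]
    simp_rw [fun i j => hsymm j i]
  rw [← Finset.sum_add_sum_compl S]
  simp_rw [h1, Finset.sum_add_distrib]
  rw [h2]; ring

/-- The pairs `i < j` separated by `a` include all pairs between a level set of `a` and its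
complement. -/
lemma sum_levelSet_compl_le_sum_separated (hsymm : ∀ i j, f i j = f j i)
    (hnonneg : ∀ i j, 0 ≤ f i j) (a : Fin n → ℝ) (c : ℝ) :
    ∑ i with a i = c, ∑ j ∈ (Finset.univ.filter fun i => a i = c)ᶜ, f i j ≤
      ∑ p ∈ Finset.univ.filter (fun p : Fin n × Fin n => p.1 < p.2 ∧ a p.1 ≠ a p.2),
        f p.1 p.2 := by
  classical
  set S : Finset (Fin n) := Finset.univ.filter fun i => a i = c
  let g : Fin n → Fin n → ℝ := fun i j => if a i ≠ a j then f i j else 0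
  have gsymm : ∀ i j, g i j = g j i := fun i j => by simp only [g, ne_comm, hsymm i j]
  have gnonneg : ∀ i j, 0 ≤ g i j := fun i j => by
    simp only [g]; split_ifs <;> simp [hnonneg]
  have h1 := sum_sum_eq_two_mul_sum_Ioi gsymm (by simp [g])
  have h2 := sum_univ_sum_univ_eq_sum_blocks gsymm S
  have h3 : ∑ i ∈ S, ∑ j ∈ Sᶜ, g i j = ∑ i ∈ S, ∑ j ∈ Sᶜ, f i j := by
    refine Finset.sum_congr rfl fun i hi => Finset.sum_congr rfl fun j hj => ?_
    have hi' : a i = c := by simpa [S] using hi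
    have hj' : a j ≠ c := by simpa [S] using hj
    simp [g, hi', hj'.symm]
  have h4 : ∑ p ∈ Finset.univ.filter (fun p : Fin n × Fin n => p.1 < p.2 ∧ a p.1 ≠ a p.2),
      f p.1 p.2 = ∑ i, ∑ j ∈ Finset.Ioi i, g i j := by
    rw [Finset.sum_filter, Fintype.sum_prod_type]
    refine Finset.sum_congr rfl fun i _ => ?_
    have hI : Finset.Ioi i = Finset.univ.filter (fun j => i < j) := by ext; simp
    rw [hI, Finset.sum_filter]
    refine Finset.sum_congr rfl fun j _ => ?_
    simp only [g]
    split_ifs <;> simp_all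
  have h5 : 0 ≤ ∑ i ∈ S, ∑ j ∈ S, g i j :=
    Finset.sum_nonneg fun i _ => Finset.sum_nonneg fun j _ => gnonneg i j
  have h6 : 0 ≤ ∑ i ∈ Sᶜ, ∑ j ∈ Sᶜ, g i j :=
    Finset.sum_nonneg fun i _ => Finset.sum_nonneg fun j _ => gnonneg i j
  rw [h4]
  linarith

/-- Within a block, distances are bounded by going through a point `t`. -/
lemma sum_block_le_of_triangle (hsymm : ∀ i j, f i j = f j i) (hdiag : ∀ i, f i i = 0)
    (htri : ∀ i j k, f i k ≤ f i j + f j k) (S : Finset (Fin n)) (t : Fin n) :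
    ∑ i ∈ S, ∑ j ∈ S, f i j ≤ 2 * ((S.card : ℝ) - 1) * ∑ i ∈ S, f i t := by
  have h1 : ∀ i ∈ S, ∑ j ∈ S, f i j ≤
      (S.card : ℝ) * f i t + ∑ j ∈ S, f j t - 2 * f i t := by
    intro i hi
    have h2 : ∑ j ∈ S.erase i, f i j ≤ ∑ j ∈ S.erase i, (f i t + f j t) :=
      Finset.sum_le_sum fun j _ => by rw [hsymm j t]; exact htri i t j
    have h3 := Finset.add_sum_erase S (fun j => f i j) hi
    have h4 := Finset.add_sum_erase S (fun j => f i t + f j t) hi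
    simp only [hdiag, Finset.sum_add_distrib, Finset.sum_const, nsmul_eq_mul] at h2 h3 h4
    linarith
  refine (Finset.sum_le_sum h1).trans (le_of_eq ?_)
  rw [Finset.sum_sub_distrib, Finset.sum_add_distrib, ← Finset.mul_sum, ← Finset.mul_sum]
  simp only [Finset.sum_const, nsmul_eq_mul]
  ring

lemma sum_Ioi_le_mul_sum_block_compl (hsymm : ∀ i j, f i j = f j i) (hdiag : ∀ i, f i i = 0)
    (hnonneg : ∀ i j, 0 ≤ f i j) (htri : ∀ i j k, f i k ≤ f i j + f j k)
    {S : Finset (Fin n)} (hS : S.Nonempty) (hSc : Sᶜ.Nonempty) :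
    ∑ i, ∑ j ∈ Finset.Ioi i, f i j ≤ ((n : ℝ) - 1) * ∑ i ∈ S, ∑ j ∈ Sᶜ, f i j := by
  have key : ∀ A : Finset (Fin n), A.Nonempty → Aᶜ.Nonempty →
      ∑ i ∈ A, ∑ j ∈ A, f i j ≤ 2 * ((A.card : ℝ) - 1) * ∑ i ∈ A, ∑ j ∈ Aᶜ, f i j := by
    rintro A hA ⟨t, ht⟩
    refine (sum_block_le_of_triangle hsymm hdiag htri A t).trans ?_
    have hcard : (1 : ℝ) ≤ A.card := by exact_mod_cast hA.card_pos
    refine mul_le_mul_of_nonneg_left (Finset.sum_le_sum fun i _ => ?_) (by linarith)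
    exact Finset.single_le_sum (f := fun j => f i j) (fun j _ => hnonneg i j) ht
  have h1 := key S hS hSc
  have h2 := key Sᶜ hSc (by simpa using hS)
  have h3 : ∑ i ∈ Sᶜ, ∑ j ∈ Sᶜᶜ, f i j = ∑ i ∈ S, ∑ j ∈ Sᶜ, f i j := by
    rw [compl_compl, Finset.sum_comm]
    simp_rw [fun i j => hsymm j i]
  rw [h3] at h2
  have h4 := sum_sum_eq_two_mul_sum_Ioi hsymm hdiag
  have h5 := sum_univ_sum_univ_eq_sum_blocks hsymm S
  have h6 : (S.card : ℝ) + (Sᶜ.card : ℝ) = n := by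
    exact_mod_cast (Finset.card_add_card_compl S).trans (Fintype.card_fin n)
  rw [← h6]
  linarith

end SymmetricSums

/-- The complete bipartite graph Laplacian has spectral gap at least `1`. -/
lemma sum_sq_le_sum_block_compl_sq {n : ℕ} {x : Fin n → ℝ} (hx : ∑ i, x i = 0)
    {S : Finset (Fin n)} (hS : S.Nonempty) (hSc : Sᶜ.Nonempty) :
    ∑ i, x i ^ 2 ≤ ∑ i ∈ S, ∑ j ∈ Sᶜ, (x i - x j) ^ 2 := by
  have h1 : ∑ i ∈ S, ∑ j ∈ Sᶜ, (x i - x j) ^ 2 =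
      Sᶜ.card * ∑ i ∈ S, x i ^ 2 + S.card * ∑ j ∈ Sᶜ, x j ^ 2
        - 2 * (∑ i ∈ S, x i) * ∑ j ∈ Sᶜ, x j := by
    simp_rw [sub_sq, Finset.sum_add_distrib, Finset.sum_sub_distrib, Finset.sum_const,
      nsmul_eq_mul, ← Finset.mul_sum, ← Finset.sum_mul]
    rw [← Finset.mul_sum]
    ring
  rw [← Finset.sum_add_sum_compl S] at hx
  rw [h1, ← Finset.sum_add_sum_compl S, eq_neg_of_add_eq_zero_right hx]
  have h2 : (1 : ℝ) ≤ S.card := by exact_mod_cast hS.card_pos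
  have h3 : (1 : ℝ) ≤ Sᶜ.card := by exact_mod_cast hSc.card_pos
  have h4 : 0 ≤ ∑ i ∈ S, x i ^ 2 := Finset.sum_nonneg fun i _ => sq_nonneg _
  have h5 : 0 ≤ ∑ i ∈ Sᶜ, x i ^ 2 := Finset.sum_nonneg fun i _ => sq_nonneg _
  nlinarith [sq_nonneg (∑ i ∈ S, x i), mul_nonneg (sub_nonneg.2 h3) h4,
    mul_nonneg (sub_nonneg.2 h2) h5]

lemma sum_sq_le_prod_one_add_sq {ι : Type*} (s : Finset ι) {x : ι → ℝ}
    (hx : ∀ i ∈ s, 0 ≤ x i) : ∑ i ∈ s, x i ^ 2 ≤ (∏ i ∈ s, (1 + x i)) ^ 2 := by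
  have h : 1 + ∑ i ∈ s, x i ^ 2 ≤ (∏ i ∈ s, (1 + x i)) ^ 2 := by
    classical
    induction s using Finset.induction_on with
    | empty => simp
    | insert i s hi ih =>
      rw [Finset.sum_insert hi, Finset.prod_insert hi, mul_pow]
      have ih' := ih fun j hj => hx j (Finset.mem_insert_of_mem hj)
      have hxi := hx i (Finset.mem_insert_self i s)
      have hs : 0 ≤ ∑ j ∈ s, x j ^ 2 := Finset.sum_nonneg fun j _ => sq_nonneg _
      calc 1 + (x i ^ 2 + ∑ j ∈ s, x j ^ 2) ≤ (1 + x i) ^ 2 * (1 + ∑ j ∈ s, x j ^ 2) := by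
            nlinarith [mul_nonneg hxi hs, mul_nonneg (sq_nonneg (x i)) hs]
        _ ≤ _ := mul_le_mul_of_nonneg_left ih' (sq_nonneg _)
  linarith

lemma log_one_add_abs_sub_triangle (x y z : ℝ) :
    Real.log (1 + |x - z|) ≤ Real.log (1 + |x - y|) + Real.log (1 + |y - z|) := by
  rw [← Real.log_mul (by positivity) (by positivity)]
  refine Real.log_le_log (by positivity) ?_
  nlinarith [abs_sub_le x y z, mul_nonneg (abs_nonneg (x - y)) (abs_nonneg (y - z))]

/-- type `A_{n−1}` decay bound. For `a ∈ ℝ^n` with not all coordinates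
equal, there is `C > 0` such that for all integers `k ≥ n−1` and all dominant `λ`
(nonincreasing coordinates, sum zero), writing
`P = ∏_{i<j, a_i ≠ a_j} (1+λ_i−λ_j)^{−η₀k} · ∏_{i<j} (1+λ_i−λ_j)^{η₀}`,
one has `P ≤ C·min(1, ‖λ‖^{−η₀(k−n+1)})`.  This is formalized in the equivalent form
`max 1 (‖λ‖^{η₀(k−n+1)}) · P ≤ C` (equivalent since `C > 0`, and avoiding the junk
value `0^{−e} = 0`); note `k + 1 - n = k − n + 1` in ℕ for `k ≥ n−1`. -/
theorem stmt_10 (n : ℕ) (hn : 2 ≤ n) (η₀ : ℕ) (hη₀ : 1 ≤ η₀)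
    (a : Fin n → ℝ) (ha : ∃ i j : Fin n, a i ≠ a j) :
    ∃ C : ℝ, 0 < C ∧ ∀ k : ℕ, n - 1 ≤ k →
      ∀ l : EuclideanSpace ℝ (Fin n),
        (∀ i j : Fin n, i ≤ j → l j ≤ l i) →
        (∑ i, l i) = 0 →
        max 1 (‖l‖ ^ (η₀ * (k + 1 - n))) *
          ((∏ p ∈ Finset.univ.filter
              (fun p : Fin n × Fin n => p.1 < p.2 ∧ a p.1 ≠ a p.2),
              ((1 + l p.1 - l p.2) ^ (η₀ * k))⁻¹) *
            ∏ i : Fin n, ∏ j ∈ Finset.Ioi i, (1 + l i - l j) ^ η₀) ≤ C := by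
  obtain ⟨i₀, j₀, hij⟩ := ha
  refine ⟨1, one_pos, fun k hk l hl hsum => ?_⟩
  set S : Finset (Fin n) := Finset.univ.filter fun i => a i = a i₀
  have hS : S.Nonempty := ⟨i₀, by simp [S]⟩
  have hSc : Sᶜ.Nonempty := ⟨j₀, by simpa [S] using hij.symm⟩
  set D := Finset.univ.filter (fun p : Fin n × Fin n => p.1 < p.2 ∧ a p.1 ≠ a p.2)
  have hD : ∀ p ∈ D, 0 ≤ l p.1 - l p.2 := fun p hp =>
    sub_nonneg.2 (hl _ _ (Finset.mem_filter.1 hp).2.1.le)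
  have hI : ∀ i, ∀ j ∈ Finset.Ioi i, 0 ≤ l i - l j := fun i j hj =>
    sub_nonneg.2 (hl _ _ (Finset.mem_Ioi.1 hj).le)
  set P := ∏ p ∈ D, (1 + l p.1 - l p.2)
  set Q := ∏ i : Fin n, ∏ j ∈ Finset.Ioi i, (1 + l i - l j)
  have hP1 : 1 ≤ P := Finset.one_le_prod fun p hp => by linarith [hD p hp]
  have hP : 0 < P := by linarith
  have hQ : 0 < Q := Finset.prod_pos fun i _ => Finset.prod_pos fun j hj => by
    linarith [hI i j hj]
  have hnorm : ‖l‖ ≤ P := by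
    refine le_of_sq_le_sq ?_ hP.le
    calc ‖l‖ ^ 2 = ∑ i, l i ^ 2 := by simp [EuclideanSpace.norm_sq_eq]
      _ ≤ ∑ i ∈ S, ∑ j ∈ Sᶜ, (l i - l j) ^ 2 := sum_sq_le_sum_block_compl_sq hsum hS hSc
      _ ≤ ∑ p ∈ D, (l p.1 - l p.2) ^ 2 :=
        sum_levelSet_compl_le_sum_separated (f := fun i j => (l i - l j) ^ 2)
          (fun i j => by ring) (fun i j => sq_nonneg _) a (a i₀)
      _ ≤ (∏ p ∈ D, (1 + (l p.1 - l p.2))) ^ 2 := sum_sq_le_prod_one_add_sq D hD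
      _ = P ^ 2 := by simp only [P, add_sub_assoc]
  have hQP : Q ≤ P ^ (n - 1) := by
    let d : Fin n → Fin n → ℝ := fun i j => Real.log (1 + |l i - l j|)
    have dsymm : ∀ i j, d i j = d j i := fun i j => by simp only [d, abs_sub_comm]
    have dnonneg : ∀ i j, 0 ≤ d i j := fun i j =>
      Real.log_nonneg (by linarith [abs_nonneg (l i - l j)])
    have hlogP : Real.log P = ∑ p ∈ D, d p.1 p.2 := by
      rw [Real.log_prod fun p hp => by linarith [hD p hp]]
      refine Finset.sum_congr rfl fun p hp => ?_
      simp only [d, abs_of_nonneg (hD p hp), add_sub_assoc]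
    have hlogQ : Real.log Q = ∑ i, ∑ j ∈ Finset.Ioi i, d i j := by
      rw [Real.log_prod fun i _ => (Finset.prod_pos fun j hj => by linarith [hI i j hj]).ne']
      refine Finset.sum_congr rfl fun i _ => ?_
      rw [Real.log_prod fun j hj => by linarith [hI i j hj]]
      refine Finset.sum_congr rfl fun j hj => ?_
      simp only [d, abs_of_nonneg (hI i j hj), add_sub_assoc]
    rw [← Real.log_le_log_iff hQ (pow_pos hP _), Real.log_pow, hlogP, hlogQ,
      Nat.cast_sub (by omega), Nat.cast_one]
    refine (sum_Ioi_le_mul_sum_block_compl dsymm (by simp [d]) dnonneg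
      (fun i j k => log_one_add_abs_sub_triangle _ _ _) hS hSc).trans ?_
    refine mul_le_mul_of_nonneg_left
      (sum_levelSet_compl_le_sum_separated dsymm dnonneg a (a i₀)) ?_
    have : (2 : ℝ) ≤ n := by exact_mod_cast hn
    linarith
  have hmax : max 1 (‖l‖ ^ (η₀ * (k + 1 - n))) ≤ P ^ (η₀ * (k + 1 - n)) :=
    max_le (one_le_pow₀ hP1) (pow_le_pow_left₀ (norm_nonneg l) hnorm _)
  have hQη : Q ^ η₀ ≤ P ^ (η₀ * (n - 1)) := by
    rw [mul_comm η₀, pow_mul]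
    exact pow_le_pow_left₀ hQ.le hQP _
  have hexp : η₀ * k = η₀ * (k + 1 - n) + η₀ * (n - 1) := by
    rw [← mul_add]; congr 1; omega
  simp only [Finset.prod_inv_distrib, Finset.prod_pow]
  calc _ ≤ P ^ (η₀ * (k + 1 - n)) * ((P ^ (η₀ * k))⁻¹ * P ^ (η₀ * (n - 1))) := by
        gcongr
    _ = 1 := by
        rw [hexp, pow_add]
        field_simp
end

section
/- Let n ≥ 4 and let η_0 ≥ 1 be an integer, and let a = (a_1,…,a_n) ∈ ℝ^n be nonzero. Then there exists a constant C > 0 such that for every integer k ≥ n−1 and every λ = (λ_1,…,λ_n) ∈ ℝ^n with λ_1 ≥ λ_2 ≥ ⋯ ≥ λ_{n−1} ≥ |λ_n|, one has ( ∏_{1 ≤ i < j ≤ n, a_i ≠ a_j} (1 + λ_i − λ_j)^{−η_0 k} · ∏_{1 ≤ i < j ≤ n, a_i ≠ −a_j} (1 + λ_i + λ_j)^{−η_0 k} ) · ∏_{1 ≤ i < j ≤ n} (1 + λ_i − λ_j)^{η_0}(1 + λ_i + λ_j)^{η_0} ≤ C · min(1, ‖λ‖^{−2η_0(k−n+1)}),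 where ‖·‖ is the Euclidean norm. -/
open Finset

theorem Finset.prod_offDiag_prod_sdiff {ι M : Type*} [DecidableEq ι] [CommMonoid M]
    (s : Finset ι) (f : ι → ι → M) :
    ∏ p ∈ s.offDiag, ∏ k ∈ s \ {p.1, p.2}, f p.1 k =
      (∏ p ∈ s.offDiag, f p.1 p.2) ^ (#s - 2) := by
  rw [← prod_pow]
  have h : ∀ p ∈ s.offDiag, f p.1 p.2 ^ (#s - 2) = ∏ _k ∈ s \ {p.1, p.2}, f p.1 p.2 := by
    intro p hp
    rw [mem_offDiag] at hp
    rw [prod_const, card_sdiff_of_subset (by grind), card_pair hp.2.2]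
  rw [prod_congr rfl h, prod_sigma', prod_sigma']
  refine prod_nbij' (fun q => ⟨(q.1.1, q.2), q.1.2⟩) (fun q => ⟨(q.1.1, q.2), q.1.2⟩)
    ?_ ?_ ?_ ?_ ?_ <;> rintro ⟨⟨i, j⟩, k⟩ <;> simp <;> grind

theorem Finset.prod_offDiag_swap {ι M : Type*} [DecidableEq ι] [CommMonoid M]
    (s : Finset ι) (f : ι × ι → M) :
    ∏ p ∈ s.offDiag, f p.swap = ∏ p ∈ s.offDiag, f p := by
  refine prod_nbij' Prod.swap Prod.swap ?_ ?_ ?_ ?_ ?_ <;> rintro ⟨i, j⟩ <;> simp <;> grind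

theorem Finset.prod_prod_erase_offDiag {ι M : Type*} [DecidableEq ι] [CommMonoid M]
    (s : Finset ι) (f : ι × ι → M) :
    ∏ m ∈ s, ∏ p ∈ (s.erase m).offDiag, f p = (∏ p ∈ s.offDiag, f p) ^ (#s - 2) := by
  rw [← prod_pow, prod_comm' (t' := s.offDiag) (s' := fun p => s \ {p.1, p.2})]
  · refine prod_congr rfl fun p hp => ?_
    rw [mem_offDiag] at hp
    rw [prod_const, card_sdiff_of_subset (by grind), card_pair hp.2.2]
  · intro m p
    simp only [mem_offDiag, mem_erase, mem_sdiff, mem_insert, mem_singleton]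
    grind

theorem Finset.prod_offDiag_univ_of_symm {n : ℕ} {M : Type*} [CommMonoid M]
    (f : Fin n → Fin n → M) (hf : ∀ i j, f i j = f j i) :
    ∏ p ∈ (univ : Finset (Fin n)).offDiag, f p.1 p.2 =
      (∏ p : Fin n × Fin n with p.1 < p.2, f p.1 p.2) ^ 2 := by
  have h : (univ : Finset (Fin n)).offDiag =
      univ.filter (fun p : Fin n × Fin n => p.1 < p.2) ∪
        univ.filter (fun p : Fin n × Fin n => p.2 < p.1) := by
    ext p
    simp [lt_or_lt_iff_ne]
  rw [h, prod_union, sq]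
  · congr 1
    refine prod_nbij' Prod.swap Prod.swap ?_ ?_ ?_ ?_ ?_ <;> rintro ⟨i, j⟩ <;> simp
    intro _
    exact hf _ _
  · rw [disjoint_filter]
    intro p _ h1 h2
    exact lt_asymm h1 h2

theorem one_add_abs_sub_le (x y z : ℝ) :
    1 + |x - y| ≤ (1 + |x + z|) * (1 + |y + z|) := by
  have : |x - y| ≤ |x + z| + |y + z| := by
    simpa using abs_sub (x + z) (y + z)
  nlinarith [mul_nonneg (abs_nonneg (x + z)) (abs_nonneg (y + z))]

theorem prod_one_add_abs_sub_le {ι : Type*} [DecidableEq ι] (s : Finset ι) (hs : 3 ≤ #s)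
    (x : ι → ℝ) :
    ∏ p ∈ s.offDiag, (1 + |x p.1 - x p.2|) ≤ (∏ p ∈ s.offDiag, (1 + |x p.1 + x p.2|)) ^ 2 := by
  have h2 : #s - 2 ≠ 0 := by omega
  refine (pow_le_pow_iff_left₀ (by positivity) (by positivity) h2).1 ?_
  have e1 := s.prod_offDiag_prod_sdiff fun i k => 1 + |x i + x k|
  have e2 := s.prod_offDiag_swap fun p => ∏ k ∈ s \ {p.1, p.2}, (1 + |x p.1 + x k|)
  rw [e1] at e2
  rw [← prod_pow, ← pow_mul, mul_comm, pow_mul, sq]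
  nth_rw 1 [← e1]
  rw [← e2, ← prod_mul_distrib]
  refine prod_le_prod (fun p _ => by positivity) fun p hp => ?_
  rw [mem_offDiag] at hp
  simp only [Prod.fst_swap, Prod.snd_swap]
  rw [pair_comm p.2 p.1, ← prod_mul_distrib]
  have : #(s \ {p.1, p.2}) = #s - 2 := by
    rw [card_sdiff_of_subset (by grind), card_pair hp.2.2]
  rw [← this, ← prod_const]
  exact prod_le_prod (fun p _ => by positivity) fun k _ => one_add_abs_sub_le _ _ _

theorem one_add_sum_sq_le_of_four (a b c d : ℝ) :
    1 + (a ^ 2 + b ^ 2 + c ^ 2 + d ^ 2) ≤ (1 + |a + b|) * (1 + |c + d|) *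
      ((1 + |a + c|) * (1 + |b + d|)) * ((1 + |a + d|) * (1 + |b + c|)) := by
  have key : a ^ 2 + b ^ 2 + c ^ 2 + d ^ 2 ≤
      (|a + b| + |c + d|) * (|a + c| + |b + d|) + |a + b| * |c + d| + |a + c| * |b + d|
        + |a + d| * |b + c| := by
    have e : a ^ 2 + b ^ 2 + c ^ 2 + d ^ 2 = (a + b + (c + d)) * (a + c + (b + d))
      - (a + b) * (c + d) - (a + c) * (b + d) - (a + d) * (b + c) := by ring
    have h1 : (a + b + (c + d)) * (a + c + (b + d)) ≤
        (|a + b| + |c + d|) * (|a + c| + |b + d|) := by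
      refine (le_abs_self _).trans ?_
      rw [abs_mul]
      gcongr <;> exact abs_add_le _ _
    have h2 : ∀ s t : ℝ, -(s * t) ≤ |s| * |t| := fun s t => by
      rw [← abs_mul]; exact neg_le_abs _
    linarith [h2 (a + b) (c + d), h2 (a + c) (b + d), h2 (a + d) (b + c)]
  have := abs_nonneg (a + b)
  have := abs_nonneg (c + d)
  have := abs_nonneg (a + c)
  have := abs_nonneg (b + d)
  have := abs_nonneg (a + d)
  have := abs_nonneg (b + c)
  generalize |a + b| = p, |c + d| = q, |a + c| = r, |b + d| = s, |a + d| = t, |b + c| = u at *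
  have h : 0 ≤ (1 + p) * (1 + q) * ((1 + r) * (1 + s)) * ((1 + t) * (1 + u)) -
      (1 + ((p + q) * (r + s) + p * q + r * s + t * u)) := by
    ring_nf
    positivity
  linarith

theorem pow_card_mul_sub_sum_le {ι : Type*} [DecidableEq ι] (s : Finset ι) (y : ι → ℝ) (N : ℝ)
    (hy : ∀ i ∈ s, 0 ≤ y i) (hN : ∀ i ∈ s, y i ≤ N) (hN0 : 0 ≤ N) :
    N ^ #s * (N - ∑ i ∈ s, y i) ≤ N * ∏ i ∈ s, (N - y i) := by
  induction s using Finset.induction_on with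
  | empty => simp
  | insert a s ha ih =>
    have ih := ih (fun i hi => hy i (mem_insert_of_mem hi)) fun i hi => hN i (mem_insert_of_mem hi)
    have hya := hy a (mem_insert_self a s)
    have hNa := hN a (mem_insert_self a s)
    have hS : 0 ≤ ∑ i ∈ s, y i := sum_nonneg fun i hi => hy i (mem_insert_of_mem hi)
    rw [card_insert_of_notMem ha, sum_insert ha, prod_insert ha]
    have h1 := mul_le_mul_of_nonneg_left ih (sub_nonneg.2 hNa)
    have h2 : 0 ≤ N ^ #s * (y a * ∑ i ∈ s, y i) := by positivity
    rw [pow_succ]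
    linarith

theorem pow_card_le_mul_prod_one_add_sum_erase {ι : Type*} [DecidableEq ι] (s : Finset ι)
    (y : ι → ℝ) (hy : ∀ i ∈ s, 0 ≤ y i) :
    (1 + ∑ i ∈ s, y i) ^ #s ≤ (1 + ∑ i ∈ s, y i) * ∏ m ∈ s, (1 + ∑ i ∈ s.erase m, y i) := by
  have hS : 0 ≤ ∑ i ∈ s, y i := sum_nonneg hy
  have h := pow_card_mul_sub_sum_le s y (1 + ∑ i ∈ s, y i) hy
    (fun i hi => (single_le_sum hy hi).trans (by linarith)) (by positivity)
  rw [add_sub_cancel_right, mul_one] at h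
  refine h.trans_eq (congrArg _ (prod_congr rfl fun m hm => ?_))
  rw [← add_sum_erase s y hm]
  ring

theorem sq_one_add_sum_sq_le {ι : Type*} [DecidableEq ι] (s : Finset ι) (hs : 4 ≤ #s)
    (x : ι → ℝ) :
    (1 + ∑ i ∈ s, x i ^ 2) ^ 2 ≤ ∏ p ∈ s.offDiag, (1 + |x p.1 + x p.2|) := by
  generalize h : #s = n at hs
  induction n, hs using Nat.le_induction generalizing s with
  | base =>
    obtain ⟨t, u, htu, rfl, ht, hu⟩ : ∃ t u, Disjoint t u ∧ t ∪ u = s ∧ #t = 2 ∧ #u = 2 := by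
      obtain ⟨t, hts, ht⟩ := exists_subset_card_eq (show 2 ≤ #s by omega)
      exact ⟨t, s \ t, disjoint_sdiff, union_sdiff_of_subset hts, ht,
        by rw [card_sdiff_of_subset hts]; omega⟩
    obtain ⟨a, b, hab, rfl⟩ := card_eq_two.1 ht
    obtain ⟨c, d, hcd, rfl⟩ := card_eq_two.1 hu
    simp only [disjoint_insert_left, mem_insert, mem_singleton, not_or,
      disjoint_singleton_left] at htu
    obtain ⟨⟨hac, had⟩, hbc, hbd⟩ := htu
    have := Ne.symm hab
    have := Ne.symm hcd
    have : c ≠ a := Ne.symm hac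
    have : d ≠ a := Ne.symm had
    have : c ≠ b := Ne.symm hbc
    have : d ≠ b := Ne.symm hbd
    have e' : ({a, b} ∪ {c, d} : Finset ι) = {a, b, c, d} := by
      ext
      simp only [mem_union, mem_insert, mem_singleton, or_assoc]
    have e : ({a, b, c, d} : Finset ι).offDiag = {(a, b), (b, a), (a, c), (c, a), (a, d),
        (d, a), (b, c), (c, b), (b, d), (d, b), (c, d), (d, c)} := by
      ext ⟨i, j⟩
      simp only [mem_offDiag, mem_insert, mem_singleton, Prod.mk.injEq]
      constructor
      · rintro ⟨rfl | rfl | rfl | rfl, rfl | rfl | rfl | rfl, h⟩ <;> simp_all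
      · rintro (⟨rfl, rfl⟩ | ⟨rfl, rfl⟩ | ⟨rfl, rfl⟩ | ⟨rfl, rfl⟩ | ⟨rfl, rfl⟩ | ⟨rfl, rfl⟩ |
          ⟨rfl, rfl⟩ | ⟨rfl, rfl⟩ | ⟨rfl, rfl⟩ | ⟨rfl, rfl⟩ | ⟨rfl, rfl⟩ | ⟨rfl, rfl⟩) <;> simp_all
    have l : ∑ i ∈ ({a, b, c, d} : Finset ι), x i ^ 2 = x a ^ 2 + x b ^ 2 + x c ^ 2 + x d ^ 2 := by
      simp [*, add_assoc]
    rw [e', e, l]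
    refine (pow_le_pow_left₀ (by positivity) (one_add_sum_sq_le_of_four _ _ _ _) 2).trans_eq ?_
    iterate 11 rw [prod_insert (by simp [*])]
    rw [prod_singleton]
    dsimp only
    rw [add_comm (x b) (x a), add_comm (x c) (x a), add_comm (x d) (x a),
      add_comm (x c) (x b), add_comm (x d) (x b), add_comm (x d) (x c)]
    ring
  | succ n hn ih =>
    set N := 1 + ∑ i ∈ s, x i ^ 2 with hN
    have hN1 : 1 ≤ N := by
      have : 0 ≤ ∑ i ∈ s, x i ^ 2 := sum_nonneg fun i _ => sq_nonneg _
      linarith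
    have hW := pow_card_le_mul_prod_one_add_sum_erase s (fun i => x i ^ 2) fun i _ => sq_nonneg _
    rw [← hN, h, pow_succ'] at hW
    have hW := le_of_mul_le_mul_left hW (by linarith)
    have h2 : #s - 2 ≠ 0 := by omega
    refine (pow_le_pow_iff_left₀ (by positivity) (by positivity) h2).1 ?_
    rw [← prod_prod_erase_offDiag]
    calc (N ^ 2) ^ (#s - 2) ≤ (N ^ 2) ^ n := pow_le_pow_right₀ (one_le_pow₀ hN1) (by omega)
      _ = (N ^ n) ^ 2 := by rw [← pow_mul, ← pow_mul, mul_comm]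
      _ ≤ (∏ m ∈ s, (1 + ∑ i ∈ s.erase m, x i ^ 2)) ^ 2 := by gcongr
      _ = ∏ m ∈ s, (1 + ∑ i ∈ s.erase m, x i ^ 2) ^ 2 := by rw [prod_pow]
      _ ≤ _ := prod_le_prod (fun m _ => by positivity) fun m hm => by
        have hc : #(s.erase m) = n := by rw [card_erase_of_mem hm]; omega
        exact ih _ hc

/-- The product of `1 + |α(x)|` over the two roots `α = e_i ± e_j`, as a function of the
coordinates `a = x_i` and `b = x_j`. -/
noncomputable def rootPair (a b : ℝ) : ℝ := (1 + |a - b|) * (1 + |a + b|)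

theorem rootPair_eq (a b : ℝ) :
    rootPair a b = 1 + 2 * max |a| |b| + |a ^ 2 - b ^ 2| := by
  have h1 : |a - b| + |a + b| = 2 * max |a| |b| := by
    grind
  rw [rootPair, sq_sub_sq, abs_mul]
  linear_combination h1

theorem rootPair_comm (a b : ℝ) : rootPair a b = rootPair b a := by
  rw [rootPair, rootPair, abs_sub_comm, add_comm a b]

theorem one_le_rootPair (a b : ℝ) : 1 ≤ rootPair a b := by
  rw [rootPair_eq]
  have : 0 ≤ max |a| |b| := le_max_of_le_left (abs_nonneg a)
  linarith [abs_nonneg (a ^ 2 - b ^ 2)]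

theorem rootPair_le_mul (a b c : ℝ) : rootPair a b ≤ rootPair a c * rootPair b c := by
  have h1 := rootPair_eq a c
  have h2 := rootPair_eq b c
  have h4 : rootPair a b ≤ rootPair a c + rootPair b c - 1 := by
    rw [rootPair_eq, h1, h2]
    have := abs_sub_le (a ^ 2) (c ^ 2) (b ^ 2)
    rw [abs_sub_comm (c ^ 2)] at this
    have h3 : max |a| |b| ≤ max |a| |c| + max |b| |c| := by grind
    linarith
  nlinarith [mul_nonneg (sub_nonneg.2 (one_le_rootPair a c)) (sub_nonneg.2 (one_le_rootPair b c))]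

theorem le_prod_rootPair {ι : Type*} (s : Finset ι) (c : ℝ) (x : ι → ℝ) :
    1 + 2 * #s * |c| + 2 * #s * (#s - 1) * c ^ 2 + ∑ i ∈ s, |c ^ 2 - x i ^ 2| ≤
      ∏ i ∈ s, rootPair c (x i) := by
  classical
  induction s using Finset.induction_on with
  | empty => simp
  | insert a s ha ih =>
    rw [prod_insert ha, sum_insert ha, card_insert_of_notMem ha]
    have h : 1 + 2 * |c| + |c ^ 2 - x a ^ 2| ≤ rootPair c (x a) := by
      rw [rootPair_eq]
      linarith [le_max_left |c| |x a|]
    have hS : 0 ≤ ∑ i ∈ s, |c ^ 2 - x i ^ 2| := sum_nonneg fun i _ => abs_nonneg _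
    have hk : (0 : ℝ) ≤ #s * (#s - 1) := by
      rcases Nat.eq_zero_or_pos #s with h | h
      · simp [h]
      · have : (1 : ℝ) ≤ #s := by exact_mod_cast h
        exact mul_nonneg (by linarith) (by linarith)
    have hc := abs_nonneg c
    have hd := abs_nonneg (c ^ 2 - x a ^ 2)
    rw [← sq_abs c] at *
    set C := |c|
    set d := |C ^ 2 - x a ^ 2|
    set S := ∑ i ∈ s, |C ^ 2 - x i ^ 2|
    set e := (#s : ℝ)
    have he : 0 ≤ e := Nat.cast_nonneg _
    have h1 : 0 ≤ 2 * C * (2 * (e * (e - 1)) * C ^ 2 + S) := by positivity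
    have h2 : 0 ≤ d * (2 * e * C + 2 * (e * (e - 1)) * C ^ 2 + S) := by positivity
    have h3 : 0 ≤ 2 * (e * (e - 1)) * C ^ 2 := by positivity
    have h4 : 0 ≤ 2 * e * C := by positivity
    refine le_trans ?_ (mul_le_mul h ih (by linarith) (by linarith [one_le_rootPair c (x a)]))
    push_cast
    linarith

theorem one_add_sq_add_sum_sq_le_prod_rootPair {ι : Type*} (s : Finset ι) (hs : 2 ≤ #s)
    (c : ℝ) (x : ι → ℝ) :
    1 + c ^ 2 + ∑ i ∈ s, x i ^ 2 ≤ ∏ i ∈ s, rootPair c (x i) := by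
  refine le_trans ?_ (le_prod_rootPair s c x)
  have h1 : ∑ i ∈ s, x i ^ 2 ≤ ∑ i ∈ s, (c ^ 2 + |c ^ 2 - x i ^ 2|) :=
    sum_le_sum fun i _ => by linarith [neg_le_abs (c ^ 2 - x i ^ 2)]
  rw [sum_add_distrib, sum_const, nsmul_eq_mul] at h1
  have h2 : (2 : ℝ) ≤ #s := by exact_mod_cast hs
  have h3 : 0 ≤ 2 * #s * |c| := by positivity
  have h4 : 0 ≤ (2 * (#s : ℝ) * (#s - 1) - #s - 1) * c ^ 2 :=
    mul_nonneg (by nlinarith) (sq_nonneg c)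
  linarith

theorem one_add_sum_sq_le_prod_prod_rootPair {ι : Type*} (s t : Finset ι) (hs : s.Nonempty)
    (ht : t.Nonempty) (hst : 3 ≤ #s + #t) (x : ι → ℝ) :
    1 + ∑ i ∈ s, x i ^ 2 + ∑ i ∈ t, x i ^ 2 ≤ ∏ i ∈ s, ∏ j ∈ t, rootPair (x i) (x j) := by
  have hsym : ∏ i ∈ s, ∏ j ∈ t, rootPair (x i) (x j) =
      ∏ i ∈ t, ∏ j ∈ s, rootPair (x i) (x j) := by
    rw [prod_comm]
    simp_rw [fun i j => rootPair_comm (x j) (x i)]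
  rcases (Nat.succ_le_iff.2 hs.card_pos).eq_or_lt with h1 | h1
  · obtain ⟨c, rfl⟩ := card_eq_one.1 h1.symm
    simpa using one_add_sq_add_sum_sq_le_prod_rootPair t (by omega) (x c) x
  rcases (Nat.succ_le_iff.2 ht.card_pos).eq_or_lt with h2 | h2
  · obtain ⟨c, rfl⟩ := card_eq_one.1 h2.symm
    rw [hsym]
    simpa [add_right_comm] using one_add_sq_add_sum_sq_le_prod_rootPair s (by omega) (x c) x
  have key : ∀ u v : Finset ι, 1 < #u → 1 < #v →
      (1 + ∑ i ∈ v, x i ^ 2) ^ 2 ≤ ∏ i ∈ u, ∏ j ∈ v, rootPair (x i) (x j) := by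
    intro u v hu hv
    have h0 : 0 ≤ ∑ i ∈ v, x i ^ 2 := sum_nonneg fun i _ => sq_nonneg _
    calc (1 + ∑ i ∈ v, x i ^ 2) ^ 2 ≤ (1 + ∑ i ∈ v, x i ^ 2) ^ #u :=
          pow_le_pow_right₀ (by linarith) hu
      _ = ∏ _i ∈ u, (1 + ∑ i ∈ v, x i ^ 2) := by rw [prod_const]
      _ ≤ _ := prod_le_prod (fun i _ => by positivity) fun i _ => by
        have := one_add_sq_add_sum_sq_le_prod_rootPair v hv (x i) x
        linarith [sq_nonneg (x i)]
  have k1 := key s t h1 h2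
  have k2 := key t s h2 h1
  rw [← hsym] at k2
  have hs0 : 0 ≤ ∑ i ∈ s, x i ^ 2 := sum_nonneg fun i _ => sq_nonneg _
  have ht0 : 0 ≤ ∑ i ∈ t, x i ^ 2 := sum_nonneg fun i _ => sq_nonneg _
  nlinarith

theorem Finset.prod_offDiag_mul {ι M : Type*} [DecidableEq ι] [CommMonoid M]
    (s : Finset ι) (f : ι → M) :
    ∏ p ∈ s.offDiag, f p.1 * f p.2 = (∏ i ∈ s, f i) ^ (2 * (#s - 1)) := by
  have h : ∏ p ∈ s.offDiag, f p.1 = (∏ i ∈ s, f i) ^ (#s - 1) := by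
    rw [← prod_pow]
    have : ∀ i ∈ s, f i ^ (#s - 1) = ∏ _j ∈ s.erase i, f i := fun i hi => by
      rw [prod_const, card_erase_of_mem hi]
    rw [prod_congr rfl this, prod_sigma']
    refine prod_nbij' (fun p => ⟨p.1, p.2⟩) (fun q => (q.1, q.2)) ?_ ?_ ?_ ?_ ?_ <;>
      rintro ⟨i, j⟩ <;> simp <;> grind
  have h' : ∏ p ∈ s.offDiag, f p.2 = ∏ p ∈ s.offDiag, f p.1 :=
    s.prod_offDiag_swap fun p => f p.1
  rw [prod_mul_distrib, h', h, ← pow_add, two_mul]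

theorem Finset.prod_offDiag_union {ι M : Type*} [DecidableEq ι] [CommMonoid M]
    {s t : Finset ι} (h : Disjoint s t) (f : ι → ι → M) :
    ∏ p ∈ (s ∪ t).offDiag, f p.1 p.2 =
      (∏ p ∈ s.offDiag, f p.1 p.2) * (∏ p ∈ t.offDiag, f p.1 p.2) *
        ((∏ i ∈ s, ∏ j ∈ t, f i j) * ∏ i ∈ t, ∏ j ∈ s, f i j) := by
  have hd : ∀ i ∈ s, i ∉ t := fun i hi => Finset.disjoint_left.1 h hi
  rw [offDiag_union h, prod_union, prod_union, prod_union, prod_product, prod_product, mul_assoc]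
  all_goals
    rw [Finset.disjoint_left]
    rintro ⟨i, j⟩
    simp only [mem_union, mem_offDiag, mem_product]
    grind

theorem prod_rootPair_offDiag_le {ι : Type*} [DecidableEq ι] (s t : Finset ι)
    (hst : Disjoint s t) (hs : s.Nonempty) (ht : t.Nonempty) (x : ι → ℝ) :
    ∏ p ∈ (s ∪ t).offDiag, rootPair (x p.1) (x p.2) ≤
      ((∏ i ∈ s, ∏ j ∈ t, rootPair (x i) (x j)) ^ 2) ^ (#s + #t - 1) := by
  have hsym : ∏ i ∈ t, ∏ j ∈ s, rootPair (x i) (x j) =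
      ∏ i ∈ s, ∏ j ∈ t, rootPair (x i) (x j) := by
    rw [prod_comm]
    simp_rw [fun i j => rootPair_comm (x j) (x i)]
  have hpos : ∀ a b, 0 < rootPair a b := fun a b => zero_lt_one.trans_le (one_le_rootPair a b)
  have key : ∀ u v : Finset ι, v.Nonempty → ∏ p ∈ u.offDiag, rootPair (x p.1) (x p.2) ≤
      (∏ i ∈ u, ∏ j ∈ v, rootPair (x i) (x j)) ^ (2 * (#u - 1)) := by
    rintro u v ⟨k, hk⟩
    calc _ ≤ ∏ p ∈ u.offDiag, rootPair (x p.1) (x k) * rootPair (x p.2) (x k) :=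
          prod_le_prod (fun p _ => (hpos _ _).le) fun p _ => rootPair_le_mul _ _ _
      _ = (∏ i ∈ u, rootPair (x i) (x k)) ^ (2 * (#u - 1)) :=
          u.prod_offDiag_mul fun i => rootPair (x i) (x k)
      _ ≤ _ := by
        refine pow_le_pow_left₀ (prod_nonneg fun i _ => (hpos _ _).le)
          (prod_le_prod (fun i _ => (hpos _ _).le) fun i _ => ?_) _
        rw [← mul_prod_erase v _ hk]
        exact le_mul_of_one_le_right (hpos _ _).le (Finset.one_le_prod fun j _ => one_le_rootPair _ _)
  have k1 := key s t ht
  have k2 := key t s hs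
  have c1 := hs.card_pos
  have c2 := ht.card_pos
  rw [hsym] at k2
  rw [prod_offDiag_union hst fun i j => rootPair (x i) (x j), hsym, ← sq]
  have hR : 0 < ∏ i ∈ s, ∏ j ∈ t, rootPair (x i) (x j) :=
    prod_pos fun i _ => prod_pos fun j _ => hpos _ _
  refine (mul_le_mul_of_nonneg_right (mul_le_mul k1 k2 (prod_nonneg fun p _ => (hpos _ _).le)
    (by positivity)) (by positivity)).trans_eq ?_
  rw [← pow_mul, ← pow_add, ← pow_add]
  congr 1
  omega

/-- The factor of `rootPair (x i) (x j)` coming from the roots that do not annihilate `a`. -/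
noncomputable def rootWeight {ι : Type*} (a x : ι → ℝ) (i j : ι) : ℝ :=
  (if a i ≠ a j then 1 + |x i - x j| else 1) * (if a i ≠ -a j then 1 + |x i + x j| else 1)

theorem one_le_rootWeight {ι : Type*} (a x : ι → ℝ) (i j : ι) : 1 ≤ rootWeight a x i j := by
  refine one_le_mul_of_one_le_of_one_le ?_ ?_ <;> split_ifs <;> simp

theorem rootWeight_comm {ι : Type*} (a x : ι → ℝ) (i j : ι) :
    rootWeight a x i j = rootWeight a x j i := by
  rw [rootWeight, rootWeight, abs_sub_comm, add_comm (x i)]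
  simp only [ne_comm (a := a i), ne_eq, neg_eq_iff_eq_neg]

theorem rootWeight_eq_rootPair {ι : Type*} {a : ι → ℝ} (x : ι → ℝ) {i j : ι}
    (h : |a i| ≠ |a j|) : rootWeight a x i j = rootPair (x i) (x j) := by
  rw [Ne, abs_eq_abs, not_or] at h
  rw [rootWeight, if_pos h.1, if_pos h.2, rootPair]

theorem prod_rootWeight_bounds_of_abs_eq {ι : Type*} [DecidableEq ι] (s : Finset ι)
    (hs : 4 ≤ #s) (a x : ι → ℝ) (ha : ∀ i, a i ≠ 0) (h : ∀ i j, |a i| = |a j|) :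
    ∏ p ∈ s.offDiag, rootPair (x p.1) (x p.2) ≤
        (∏ p ∈ s.offDiag, rootWeight a x p.1 p.2) ^ (#s - 1) ∧
      (∑ i ∈ s, x i ^ 2) ^ 2 ≤ ∏ p ∈ s.offDiag, rootWeight a x p.1 p.2 := by
  set y : ι → ℝ := fun i => if 0 < a i then x i else -x i with hy
  have hw : ∀ i j, rootWeight a x i j = 1 + |y i + y j| := by
    intro i j
    have hi := ha i
    have hj := ha j
    have hij := h i j
    simp only [rootWeight, hy]
    grind
  have hp : ∀ i j, rootPair (x i) (x j) = (1 + |y i - y j|) * (1 + |y i + y j|) := by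
    intro i j
    simp only [rootPair, hy]
    grind
  have hsq : ∀ i, x i ^ 2 = y i ^ 2 := by
    intro i
    simp only [hy]
    split_ifs <;> ring
  simp only [hw, hp, hsq]
  have h1 : 1 ≤ ∏ p ∈ s.offDiag, (1 + |y p.1 + y p.2|) :=
    Finset.one_le_prod fun p _ => by simp
  constructor
  · rw [prod_mul_distrib]
    calc _ ≤ (∏ p ∈ s.offDiag, (1 + |y p.1 + y p.2|)) ^ 2 *
          ∏ p ∈ s.offDiag, (1 + |y p.1 + y p.2|) :=
          mul_le_mul_of_nonneg_right (prod_one_add_abs_sub_le s (by omega) y) (by linarith)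
      _ = (∏ p ∈ s.offDiag, (1 + |y p.1 + y p.2|)) ^ 3 := by ring
      _ ≤ _ := pow_le_pow_right₀ h1 (by omega)
  · have h0 : 0 ≤ ∑ i ∈ s, y i ^ 2 := sum_nonneg fun i _ => sq_nonneg _
    exact (pow_le_pow_left₀ h0 (by linarith) 2).trans (sq_one_add_sum_sq_le s hs y)

theorem prod_rootWeight_bounds {ι : Type*} [Fintype ι] [DecidableEq ι]
    (hι : 4 ≤ Fintype.card ι) (a x : ι → ℝ) (ha : a ≠ 0) :
    ∏ p ∈ (univ : Finset ι).offDiag, rootPair (x p.1) (x p.2) ≤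
        (∏ p ∈ (univ : Finset ι).offDiag, rootWeight a x p.1 p.2) ^ (Fintype.card ι - 1) ∧
      (∑ i, x i ^ 2) ^ 2 ≤ ∏ p ∈ (univ : Finset ι).offDiag, rootWeight a x p.1 p.2 := by
  obtain ⟨i₀, hi₀⟩ := Function.ne_iff.1 ha
  by_cases h : ∀ i, |a i| = |a i₀|
  · refine prod_rootWeight_bounds_of_abs_eq univ hι a x (fun i hi => hi₀ ?_) fun i j => ?_
    · have := h i
      rw [hi, abs_zero] at this
      exact abs_eq_zero.1 this.symm
    · rw [h i, h j]
  obtain ⟨k, hk⟩ := not_forall.1 h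
  set s : Finset ι := {i | |a i| = |a i₀|} with hs
  set t : Finset ι := {i | |a i| ≠ |a i₀|} with ht
  have hsn : s.Nonempty := ⟨i₀, by simp [hs]⟩
  have htn : t.Nonempty := ⟨k, by simpa [ht] using hk⟩
  have hd : Disjoint s t := disjoint_filter_filter_not _ _ _
  have hu : s ∪ t = univ := filter_union_filter_not_eq _ _
  have hc : #s + #t = Fintype.card ι := by rw [← card_union_of_disjoint hd, hu, card_univ]
  have hR : (∏ i ∈ s, ∏ j ∈ t, rootPair (x i) (x j)) ^ 2 ≤
      ∏ p ∈ (univ : Finset ι).offDiag, rootWeight a x p.1 p.2 := by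
    have e1 : ∏ i ∈ s, ∏ j ∈ t, rootPair (x i) (x j) = ∏ i ∈ s, ∏ j ∈ t, rootWeight a x i j := by
      refine prod_congr rfl fun i hi => prod_congr rfl fun j hj => ?_
      simp only [hs, ht, mem_filter, mem_univ, true_and] at hi hj
      exact (rootWeight_eq_rootPair x (hi ▸ hj.symm)).symm
    have e2 : ∏ i ∈ t, ∏ j ∈ s, rootWeight a x i j = ∏ i ∈ s, ∏ j ∈ t, rootWeight a x i j := by
      rw [prod_comm]
      simp_rw [fun i j => rootWeight_comm a x j i]
    rw [← hu, prod_offDiag_union hd, e1, e2, ← sq]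
    have h1 : ∀ u : Finset ι, 1 ≤ ∏ p ∈ u.offDiag, rootWeight a x p.1 p.2 :=
      fun u => Finset.one_le_prod fun p _ => one_le_rootWeight _ _ _ _
    exact le_mul_of_one_le_left (sq_nonneg _) (one_le_mul_of_one_le_of_one_le (h1 s) (h1 t))
  have hA := prod_rootPair_offDiag_le s t hd hsn htn x
  have hB := one_add_sum_sq_le_prod_prod_rootPair s t hsn htn (by omega) x
  rw [hu, hc] at hA
  refine ⟨hA.trans (pow_le_pow_left₀ (sq_nonneg _) hR _), le_trans ?_ hR⟩
  rw [← hu, sum_union hd]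
  have hs0 : 0 ≤ ∑ i ∈ s, x i ^ 2 := sum_nonneg fun i _ => sq_nonneg _
  have ht0 : 0 ≤ ∑ i ∈ t, x i ^ 2 := sum_nonneg fun i _ => sq_nonneg _
  exact pow_le_pow_left₀ (by positivity) (by linarith) 2


/-- type `D_n` decay bound (`n ≥ 4`). For nonzero `a ∈ ℝ^n` there is
`C > 0` such that for all integers `k ≥ n−1` and all dominant `λ`
(`λ_1 ≥ ⋯ ≥ λ_{n−1} ≥ |λ_n|`), writing
`P = ∏_{i<j, a_i≠a_j} (1+λ_i−λ_j)^{−η₀k} · ∏_{i<j, a_i≠−a_j} (1+λ_i+λ_j)^{−η₀k}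
     · ∏_{i<j} (1+λ_i−λ_j)^{η₀}(1+λ_i+λ_j)^{η₀}`,
one has `P ≤ C·min(1, ‖λ‖^{−2η₀(k−n+1)})`, formalized equivalently (since `C > 0`,
avoiding the junk value `0^{−e} = 0`) as `max 1 (‖λ‖^{2η₀(k−n+1)}) · P ≤ C`. -/
theorem stmt_11 (n : ℕ) (hn : 4 ≤ n) (η₀ : ℕ) (hη₀ : 1 ≤ η₀)
    (a : Fin n → ℝ) (ha : a ≠ 0) :
    ∃ C : ℝ, 0 < C ∧ ∀ k : ℕ, n - 1 ≤ k →
      ∀ l : EuclideanSpace ℝ (Fin n),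
        (∀ i j : Fin n, i ≤ j → (j : ℕ) < n - 1 → l j ≤ l i) →
        |l ⟨n - 1, by omega⟩| ≤ l ⟨n - 2, by omega⟩ →
        max 1 (‖l‖ ^ (2 * η₀ * (k + 1 - n))) *
          ((∏ p ∈ Finset.univ.filter
              (fun p : Fin n × Fin n => p.1 < p.2 ∧ a p.1 ≠ a p.2),
              ((1 + l p.1 - l p.2) ^ (η₀ * k))⁻¹) *
            (∏ p ∈ Finset.univ.filter
              (fun p : Fin n × Fin n => p.1 < p.2 ∧ a p.1 ≠ -a p.2),
              ((1 + l p.1 + l p.2) ^ (η₀ * k))⁻¹) *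
            ∏ i : Fin n, ∏ j ∈ Finset.Ioi i,
              (1 + l i - l j) ^ η₀ * (1 + l i + l j) ^ η₀) ≤ C := by
  refine ⟨1, one_pos, fun k hk l hmono hlast => ?_⟩
  have hdom : ∀ i j : Fin n, i < j → 0 ≤ l i - l j ∧ 0 ≤ l i + l j := by
    intro i j hij
    have hij' : (i : ℕ) < j := hij
    have hlt := j.isLt
    have hi := hmono i ⟨n - 2, by omega⟩ (Fin.mk_le_mk.2 (by omega)) (by simp only; omega)
    have habs := abs_nonneg (l ⟨n - 1, by omega⟩)
    by_cases hj : (j : ℕ) < n - 1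
    · have h1 := hmono i j hij.le hj
      have h2 := hmono j ⟨n - 2, by omega⟩ (Fin.mk_le_mk.2 (by omega)) (by simp only; omega)
      constructor <;> linarith
    · have hj' : j = ⟨n - 1, by omega⟩ := Fin.ext (by simp only; omega)
      rw [hj']
      have h1 := abs_le.1 (hlast.trans hi)
      constructor <;> linarith [h1.1, h1.2]
  set E : Finset (Fin n × Fin n) := {p | p.1 < p.2} with hE
  have hE' : ∀ p ∈ E, p.1 < p.2 := fun p hp => by simpa [hE] using hp
  set Q := ∏ p ∈ E, rootWeight a l p.1 p.2 with hQ
  set F := ∏ p ∈ E, rootPair (l p.1) (l p.2) with hF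
  have hQ1 : 1 ≤ Q := Finset.one_le_prod fun p _ => one_le_rootWeight _ _ _ _
  have hF0 : 0 ≤ F := prod_nonneg fun p _ => zero_le_one.trans (one_le_rootPair _ _)
  obtain ⟨hFQ, hlQ⟩ := prod_rootWeight_bounds (by simpa using hn) a l ha
  rw [prod_offDiag_univ_of_symm _ (rootWeight_comm a l)] at hFQ hlQ
  rw [Fintype.card_fin, prod_offDiag_univ_of_symm (fun i j => rootPair (l i) (l j))
    fun i j => rootPair_comm _ _, ← pow_mul, mul_comm, pow_mul] at hFQ
  have hFQ : F ≤ Q ^ (n - 1) := (pow_le_pow_iff_left₀ hF0 (by positivity) two_ne_zero).1 hFQ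
  have hlQ : ‖l‖ ^ 2 ≤ Q := by
    rw [EuclideanSpace.real_norm_sq_eq]
    exact (pow_le_pow_iff_left₀ (sum_nonneg fun i _ => sq_nonneg _) (by positivity)
      two_ne_zero).1 hlQ
  have hinv : (∏ p ∈ univ.filter (fun p : Fin n × Fin n => p.1 < p.2 ∧ a p.1 ≠ a p.2),
        ((1 + l p.1 - l p.2) ^ (η₀ * k))⁻¹) *
      (∏ p ∈ univ.filter (fun p : Fin n × Fin n => p.1 < p.2 ∧ a p.1 ≠ -a p.2),
        ((1 + l p.1 + l p.2) ^ (η₀ * k))⁻¹) = (Q ^ (η₀ * k))⁻¹ := by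
    rw [hQ, ← prod_pow, ← prod_inv_distrib, ← filter_filter, ← filter_filter, ← hE,
      prod_filter (s := E), prod_filter (s := E), ← prod_mul_distrib]
    refine prod_congr rfl fun p hp => ?_
    obtain ⟨h1, h2⟩ := hdom _ _ (hE' p hp)
    rw [rootWeight, abs_of_nonneg h1, abs_of_nonneg h2, mul_pow, mul_inv, add_sub_assoc,
      add_assoc]
    split_ifs <;> simp
  have hfull : ∏ i : Fin n, ∏ j ∈ Ioi i, (1 + l i - l j) ^ η₀ * (1 + l i + l j) ^ η₀ =
      F ^ η₀ := by
    rw [hF, ← prod_pow, prod_finset_product E univ (fun i => Ioi i) (by simp [hE])]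
    refine prod_congr rfl fun i _ => prod_congr rfl fun j hj => ?_
    obtain ⟨h1, h2⟩ := hdom i j (mem_Ioi.1 hj)
    rw [rootPair, abs_of_nonneg h1, abs_of_nonneg h2, mul_pow, add_sub_assoc, add_assoc]
  rw [hinv, hfull]
  have hmax : max 1 (‖l‖ ^ (2 * η₀ * (k + 1 - n))) ≤ Q ^ (η₀ * (k + 1 - n)) := by
    refine max_le (one_le_pow₀ hQ1) ?_
    rw [mul_assoc, pow_mul]
    exact pow_le_pow_left₀ (sq_nonneg _) hlQ _
  have hQ0 : 0 < Q ^ (η₀ * k) := by positivity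
  calc max 1 (‖l‖ ^ (2 * η₀ * (k + 1 - n))) * ((Q ^ (η₀ * k))⁻¹ * F ^ η₀)
      ≤ Q ^ (η₀ * (k + 1 - n)) * ((Q ^ (η₀ * k))⁻¹ * (Q ^ (n - 1)) ^ η₀) := by gcongr
    _ = (Q ^ (η₀ * k))⁻¹ * Q ^ (η₀ * (k + 1 - n) + (n - 1) * η₀) := by
      rw [pow_add, pow_mul Q (n - 1)]
      ring
    _ = (Q ^ (η₀ * k))⁻¹ * Q ^ (η₀ * k) := by
      rw [mul_comm (n - 1), ← mul_add, show k + 1 - n + (n - 1) = k by omega]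
    _ = 1 := inv_mul_cancel₀ hQ0.ne'
end

section
/- Let t > 0, let A be a nonzero real number and B ≥ 0, and let φ, h : [1,∞) → ℝ be measurable functions such that |φ(λ) − A·λ^{−1/2}·cos(tλ/2 − π/4)| ≤ B·λ^{−3/2} for all λ ≥ 1, and such that h(λ)·λ^{−1/2} → 2√π as λ → ∞. Then ∫_1^∞ φ(λ)^4 · h(λ)^2 dλ = +∞. -/
open MeasureTheory Filter

/-- If a nonnegative `f` dominates the derivative of a function tending to `∞`, then its integral
diverges. -/
theorem lintegral_Ici_eq_top_of_deriv_le {f G G' : ℝ → ℝ} {a L : ℝ} (haL : a ≤ L)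
    (hf : Measurable f) (hf0 : ∀ x, 0 ≤ f x)
    (hG : ∀ x, L ≤ x → HasDerivAt G (G' x) x) (hG' : ContinuousOn G' (Set.Ici L))
    (hle : ∀ x, L ≤ x → G' x ≤ f x) (hlim : Tendsto G atTop atTop) :
    ∫⁻ x in Set.Ici a, ENNReal.ofReal (f x) = ⊤ := by
  by_contra hne
  have hint : IntegrableOn f (Set.Ici a) :=
    (lintegral_ofReal_ne_top_iff_integrable hf.aestronglyMeasurable
      (Eventually.of_forall hf0)).1 hne
  have key : ∀ R, L ≤ R → G R ≤ G L + ∫ x in Set.Ici a, f x := by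
    intro R hR
    have hsub : Set.Icc L R ⊆ Set.Ici L := fun x hx => hx.1
    have hGi : IntervalIntegrable G' volume L R :=
      (hG'.mono (by rwa [Set.uIcc_of_le hR])).intervalIntegrable
    have hIoc : Set.Ioc L R ⊆ Set.Ici a := fun x hx => haL.trans hx.1.le
    have hfi : IntervalIntegrable f volume L R :=
      (intervalIntegrable_iff_integrableOn_Ioc_of_le hR).2 (hint.mono_set hIoc)
    have hftc : ∫ x in L..R, G' x = G R - G L :=
      intervalIntegral.integral_eq_sub_of_hasDerivAt
        (fun x hx => hG x (by rw [Set.uIcc_of_le hR] at hx; exact hx.1)) hGi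
    have hmono : ∫ x in L..R, G' x ≤ ∫ x in L..R, f x :=
      intervalIntegral.integral_mono_on hR hGi hfi fun x hx => hle x hx.1
    have hset : ∫ x in L..R, f x ≤ ∫ x in Set.Ici a, f x := by
      rw [intervalIntegral.integral_of_le hR]
      exact setIntegral_mono_set hint (Eventually.of_forall hf0) hIoc.eventuallyLE
    linarith
  obtain ⟨R, hR, hLR⟩ :=
    ((hlim.eventually_gt_atTop (G L + ∫ x in Set.Ici a, f x)).and (eventually_ge_atTop L)).exists
  exact (key R hLR).not_gt hR

theorem hasDerivAt_log_sub_cos_div_add_inv {t : ℝ} (ht : t ≠ 0) (a b K : ℝ) {x : ℝ} (hx : x ≠ 0) :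
    HasDerivAt (fun x => a * Real.log x - b * (Real.cos (t * x) / (t * x)) + K * x⁻¹)
      (a * x⁻¹ + b * (Real.sin (t * x) / x + Real.cos (t * x) / (t * x ^ 2)) - K / x ^ 2) x := by
  have hlin : HasDerivAt (fun x : ℝ => t * x) t x := by
    simpa using (hasDerivAt_id x).const_mul t
  have h := (((Real.hasDerivAt_log hx).const_mul a).sub
    ((hlin.cos.div hlin (mul_ne_zero ht hx)).const_mul b)).add ((hasDerivAt_inv hx).const_mul K)
  refine h.congr_deriv ?_
  field_simp
  ring

theorem tendsto_log_sub_cos_div_add_inv {a : ℝ} (ha : 0 < a) {t : ℝ} (ht : 0 < t) {b : ℝ}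
    (hb : 0 ≤ b) {K : ℝ} (hK : 0 ≤ K) :
    Tendsto (fun x => a * Real.log x - b * (Real.cos (t * x) / (t * x)) + K * x⁻¹)
      atTop atTop := by
  refine tendsto_atTop_mono' atTop ?_
    (tendsto_atTop_add_const_right atTop (-(b * (1 / t))) (Real.tendsto_log_atTop.const_mul_atTop ha))
  filter_upwards [eventually_ge_atTop 1] with x hx
  have hx0 : 0 < x := by linarith
  have hcos : Real.cos (t * x) / (t * x) ≤ 1 / t := by
    gcongr
    · exact Real.cos_le_one _
    · nlinarith
  have := mul_le_mul_of_nonneg_left hcos hb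
  have : 0 ≤ K * x⁻¹ := by positivity
  linarith

theorem add_pow_four_ge (x y : ℝ) : x ^ 4 - 8 * y ^ 4 ≤ 8 * (x + y) ^ 4 := by
  have h1 : x ^ 2 ≤ 2 * ((x + y) ^ 2 + y ^ 2) := by nlinarith [sq_nonneg (x + 2 * y)]
  nlinarith [sq_nonneg ((x + y) ^ 2 - y ^ 2), sq_nonneg x, pow_le_pow_left₀ (sq_nonneg x) h1 2]

theorem cos_sub_pi_div_four_pow_four_ge (x : ℝ) :
    1 / 4 + Real.sin x / 2 ≤ Real.cos (x / 2 - Real.pi / 4) ^ 4 := by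
  have h : Real.cos (x / 2 - Real.pi / 4) ^ 2 = 1 / 2 + Real.sin x / 2 := by
    rw [Real.cos_sq, show 2 * (x / 2 - Real.pi / 4) = x - Real.pi / 2 by ring,
      Real.cos_sub_pi_div_two]
  nlinarith [sq_nonneg (Real.cos (x / 2 - Real.pi / 4) ^ 2 - 1 / 2)]

theorem pow_four_mul_sq_ge {A B l c p q S : ℝ} (hl : 1 ≤ l)
    (hp : |p - A * l ^ (-(1 / 2) : ℝ) * c| ≤ B * l ^ (-(3 / 2) : ℝ))
    (hq : 1 ≤ q * l ^ (-(1 / 2) : ℝ)) (hS : 1 / 4 + S / 2 ≤ c ^ 4) :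
    A ^ 4 / 4 * l⁻¹ + A ^ 4 / 2 * (S / l) - 8 * B ^ 4 / l ^ 2 ≤ 8 * (p ^ 4 * q ^ 2) := by
  have hl0 : 0 < l := by linarith
  set r := l ^ (-(1 / 2) : ℝ) with hr
  have hr2 : r ^ 2 = l⁻¹ := by
    rw [hr, ← Real.rpow_natCast, ← Real.rpow_mul hl0.le, ← Real.rpow_neg_one]
    norm_num
  have hr3 : l ^ (-(3 / 2) : ℝ) = r * l⁻¹ := by
    rw [hr, ← Real.rpow_neg_one, ← Real.rpow_add hl0]
    norm_num
  have hr4 : r ^ 4 = l⁻¹ ^ 2 := by rw [← hr2]; ring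
  rw [hr3] at hp
  have hinv : l⁻¹ ≤ 1 := inv_le_one_of_one_le₀ hl
  have hinv0 : 0 < l⁻¹ := by positivity
  have he : (p - A * r * c) ^ 4 ≤ B ^ 4 * (l⁻¹ ^ 2 * l⁻¹) := by
    calc (p - A * r * c) ^ 4 = |p - A * r * c| ^ 4 := (Even.pow_abs (by decide) _).symm
      _ ≤ (B * (r * l⁻¹)) ^ 4 := by gcongr
      _ = B ^ 4 * (l⁻¹ ^ 2 * l⁻¹ ^ 4) := by rw [mul_pow, mul_pow, hr4]
      _ ≤ B ^ 4 * (l⁻¹ ^ 2 * l⁻¹) := by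
        gcongr
        exact pow_le_of_le_one hinv0.le hinv (by norm_num)
  have hp4 : A ^ 4 * l⁻¹ ^ 2 * (1 / 4 + S / 2) - 8 * (B ^ 4 * (l⁻¹ ^ 2 * l⁻¹)) ≤ 8 * p ^ 4 := by
    have h1 := add_pow_four_ge (A * r * c) (p - A * r * c)
    have h2 : (A * r * c) ^ 4 = A ^ 4 * l⁻¹ ^ 2 * c ^ 4 := by rw [mul_pow, mul_pow, hr4]
    have h3 : A ^ 4 * l⁻¹ ^ 2 * (1 / 4 + S / 2) ≤ A ^ 4 * l⁻¹ ^ 2 * c ^ 4 := by gcongr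
    rw [h2, add_sub_cancel] at h1
    linarith
  have hq2 : l ≤ q ^ 2 := by
    have h1 : 1 ≤ (q * r) ^ 2 := one_le_pow₀ hq
    rw [mul_pow, hr2, ← div_eq_mul_inv, le_div_iff₀ hl0] at h1
    linarith
  calc A ^ 4 / 4 * l⁻¹ + A ^ 4 / 2 * (S / l) - 8 * B ^ 4 / l ^ 2
      = (A ^ 4 * l⁻¹ ^ 2 * (1 / 4 + S / 2) - 8 * (B ^ 4 * (l⁻¹ ^ 2 * l⁻¹))) * l := by
        field_simp
    _ ≤ 8 * p ^ 4 * l := by gcongr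
    _ ≤ 8 * p ^ 4 * q ^ 2 := by gcongr
    _ = 8 * (p ^ 4 * q ^ 2) := by ring

/-- if `t > 0`, `A ≠ 0`, `B ≥ 0` and the measurable functions `φ, h`
satisfy `|φ(λ) − A λ^{−1/2} cos(tλ/2 − π/4)| ≤ B λ^{−3/2}` for `λ ≥ 1` and
`h(λ) λ^{−1/2} → 2√π` as `λ → ∞`, then `∫_1^∞ φ(λ)⁴ h(λ)² dλ = +∞`. -/
theorem stmt_14 (t A B : ℝ) (ht : 0 < t) (hA : A ≠ 0) (hB : 0 ≤ B)
    (φ h : ℝ → ℝ) (hφ : Measurable φ) (hh : Measurable h)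
    (hasym : ∀ l : ℝ, 1 ≤ l →
      |φ l - A * l ^ (-(1 / 2) : ℝ) * Real.cos (t * l / 2 - Real.pi / 4)| ≤
        B * l ^ (-(3 / 2) : ℝ))
    (hlim : Tendsto (fun l : ℝ => h l * l ^ (-(1 / 2) : ℝ)) atTop
      (nhds (2 * Real.sqrt Real.pi))) :
    ∫⁻ l in Set.Ici (1 : ℝ), ENNReal.ofReal (φ l ^ 4 * h l ^ 2) = ⊤ := by
  have hpi : 1 < 2 * Real.sqrt Real.pi := by
    have : 1 < Real.sqrt Real.pi := by
      rw [Real.lt_sqrt zero_le_one]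
      linarith [Real.pi_gt_three]
    linarith
  obtain ⟨L₀, hL₀⟩ := eventually_atTop.1 (hlim.eventually (lt_mem_nhds hpi))
  have hA4 : 0 < A ^ 4 := by positivity
  have hpos : ∀ x, max 1 L₀ ≤ x → 0 < x := fun x hx =>
    zero_lt_one.trans_le ((le_max_left _ _).trans hx)
  set K := 8 * B ^ 4 + A ^ 4 / 2 / t with hK
  have hK0 : 0 ≤ K := by positivity
  refine lintegral_Ici_eq_top_of_deriv_le (L := max 1 L₀) (le_max_left _ _) (by fun_prop)
    (fun x => by positivity)
    (fun x hx => (hasDerivAt_log_sub_cos_div_add_inv ht.ne' (A ^ 4 / 4) (A ^ 4 / 2) K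
      (hpos x hx).ne').div_const 8) ?_ ?_
    ((tendsto_log_sub_cos_div_add_inv (by positivity) ht (by positivity) hK0).atTop_div_const
      (by norm_num))
  · have hne : ∀ x ∈ Set.Ici (max 1 L₀), x ≠ 0 := fun x hx => (hpos x hx).ne'
    have hne2 : ∀ x ∈ Set.Ici (max 1 L₀), x ^ 2 ≠ 0 := fun x hx => pow_ne_zero 2 (hne x hx)
    have hne3 : ∀ x ∈ Set.Ici (max 1 L₀), t * x ^ 2 ≠ 0 := fun x hx =>
      mul_ne_zero ht.ne' (hne2 x hx)
    fun_prop (disch := assumption)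
  · intro x hx
    have hx0 := hpos x hx
    have hx1 : 1 ≤ x := (le_max_left _ _).trans hx
    have hbound := pow_four_mul_sq_ge hx1 (hasym x hx1)
      (hL₀ x ((le_max_right _ _).trans hx)).le (cos_sub_pi_div_four_pow_four_ge (t * x))
    have hcos : A ^ 4 / 2 * (Real.cos (t * x) / (t * x ^ 2)) ≤ A ^ 4 / 2 / t / x ^ 2 := by
      calc A ^ 4 / 2 * (Real.cos (t * x) / (t * x ^ 2)) ≤ A ^ 4 / 2 * (1 / (t * x ^ 2)) := by
            gcongr
            exact Real.cos_le_one _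
        _ = A ^ 4 / 2 / t / x ^ 2 := by field_simp
    rw [hK, add_div]
    linarith
end

section
/- Let Φ^+ ⊂ ℝ^4 be the set of 24 vectors consisting of e_i (1 ≤ i ≤ 4), e_i + e_j and e_i − e_j (1 ≤ i < j ≤ 4), and (e_1 ± e_2 ± e_3 ± e_4)/2 (all eight sign choices). Then for every nonzero a ∈ ℝ^4, the number of α ∈ Φ^+ with Euclidean inner product ⟨α, a⟩ = 0 is at most 9. -/
/-- The set of 24 positive roots of the root system of type `F₄` realized in `ℝ⁴`:
the vectors `e_i` (`1 ≤ i ≤ 4`), `e_i + e_j` and `e_i − e_j` (`1 ≤ i < j ≤ 4`), and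
`(e₁ ± e₂ ± e₃ ± e₄)/2` (all eight sign choices). -/
def F4PositiveRoots : Set (Fin 4 → ℝ) :=
  {α | (∃ i : Fin 4, α = fun k => if k = i then 1 else 0) ∨
       (∃ i j : Fin 4, i < j ∧ α = fun k => if k = i then 1 else if k = j then 1 else 0) ∨
       (∃ i j : Fin 4, i < j ∧ α = fun k => if k = i then 1 else if k = j then -1 else 0) ∨
       (∃ s : Fin 4 → ℝ, s 0 = 1 ∧ (∀ i, s i = 1 ∨ s i = -1) ∧ α = fun k => s k / 2)}

/-- The positive roots of `F₄`, enumerated. -/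
noncomputable def f4Root : Fin 24 → Fin 4 → ℝ :=
  ![![1, 0, 0, 0], ![0, 1, 0, 0], ![0, 0, 1, 0], ![0, 0, 0, 1],
    ![1, 1, 0, 0], ![1, 0, 1, 0], ![1, 0, 0, 1], ![0, 1, 1, 0],
    ![0, 1, 0, 1], ![0, 0, 1, 1], ![1, -1, 0, 0], ![1, 0, -1, 0],
    ![1, 0, 0, -1], ![0, 1, -1, 0], ![0, 1, 0, -1], ![0, 0, 1, -1],
    ![1/2, 1/2, 1/2, 1/2], ![1/2, 1/2, 1/2, -1/2],
    ![1/2, 1/2, -1/2, 1/2], ![1/2, 1/2, -1/2, -1/2],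
    ![1/2, -1/2, 1/2, 1/2], ![1/2, -1/2, 1/2, -1/2],
    ![1/2, -1/2, -1/2, 1/2], ![1/2, -1/2, -1/2, -1/2]]

/-- The square of the cosine of the angle between `f4Root i` and `a`. -/
noncomputable def f4CosSq (a : Fin 4 → ℝ) (i : Fin 24) : ℝ :=
  (∑ k, f4Root i k * a k) ^ 2 / (∑ k, f4Root i k ^ 2) / ∑ k, a k ^ 2

theorem F4PositiveRoots_subset_range : F4PositiveRoots ⊆ Set.range f4Root := by
  rintro α (⟨i, rfl⟩ | ⟨i, j, hij, rfl⟩ | ⟨i, j, hij, rfl⟩ | ⟨s, h0, hs, rfl⟩)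
  · refine ⟨![0, 1, 2, 3] i, ?_⟩
    ext k
    fin_cases i <;> fin_cases k <;> simp [f4Root]
  · refine ⟨!![0, 4, 5, 6; 0, 0, 7, 8; 0, 0, 0, 9; 0, 0, 0, 0] i j, ?_⟩
    ext k
    fin_cases i <;> fin_cases j <;> first | exact absurd hij (by decide) | skip
    all_goals fin_cases k <;> simp [f4Root]
  · refine ⟨!![0, 10, 11, 12; 0, 0, 13, 14; 0, 0, 0, 15; 0, 0, 0, 0] i j, ?_⟩
    ext k
    fin_cases i <;> fin_cases j <;> first | exact absurd hij (by decide) | skip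
    all_goals fin_cases k <;> simp [f4Root]
  · let e (i : Fin 4) (n : Fin 24) : Fin 24 := if s i = 1 then 0 else n
    refine ⟨16 + e 1 4 + e 2 2 + e 3 1, ?_⟩
    ext k
    have hne : (-1 : ℝ) ≠ 1 := by norm_num
    rcases hs 1 with h1 | h1 <;> rcases hs 2 with h2 | h2 <;> rcases hs 3 with h3 | h3 <;>
      simp only [e, h1, h2, h3, hne, if_true, if_false] <;>
      fin_cases k <;> simp [f4Root, h0, h1, h2, h3]

theorem sum_sq_pos_of_ne_zero {ι : Type*} [Fintype ι] {a : ι → ℝ} (ha : a ≠ 0) :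
    0 < ∑ k, a k ^ 2 := by
  obtain ⟨k, hk⟩ := Function.ne_iff.mp ha
  exact Finset.sum_pos' (fun _ _ => sq_nonneg _) ⟨k, Finset.mem_univ k,
    by simpa using sq_pos_of_ne_zero hk⟩

theorem f4Root_ne_zero (i : Fin 24) : f4Root i ≠ 0 := by
  fin_cases i <;> simp [f4Root]

theorem f4CosSq_le_one (a : Fin 4 → ℝ) (i : Fin 24) : f4CosSq a i ≤ 1 := by
  have hn : 0 ≤ ∑ k, a k ^ 2 := Finset.sum_nonneg fun _ _ => sq_nonneg _
  refine div_le_one_of_le₀ ?_ hn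
  rw [div_le_iff₀ (sum_sq_pos_of_ne_zero (f4Root_ne_zero i)), mul_comm]
  exact Finset.sum_mul_sq_le_sq_mul_sq _ _ _

theorem sum_f4CosSq {a : Fin 4 → ℝ} (ha : a ≠ 0) : ∑ i, f4CosSq a i = 6 := by
  have hn := (sum_sq_pos_of_ne_zero ha).ne'
  simp only [f4CosSq, ← Finset.sum_div]
  rw [div_eq_iff hn]
  simp [f4Root, Fin.sum_univ_succ]
  ring

theorem sum_f4CosSq_sq {a : Fin 4 → ℝ} (ha : a ≠ 0) : ∑ i, f4CosSq a i ^ 2 = 3 := by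
  have hn := (sum_sq_pos_of_ne_zero ha).ne'
  simp only [f4CosSq, div_pow _ (∑ k, a k ^ 2), ← Finset.sum_div]
  rw [div_eq_iff (pow_ne_zero _ hn)]
  simp [f4Root, Fin.sum_univ_succ]
  ring

theorem sum_f4CosSq_cube {a : Fin 4 → ℝ} (ha : a ≠ 0) : ∑ i, f4CosSq a i ^ 3 = 15 / 8 := by
  have hn := (sum_sq_pos_of_ne_zero ha).ne'
  simp only [f4CosSq, div_pow _ (∑ k, a k ^ 2), ← Finset.sum_div]
  rw [div_eq_iff (pow_ne_zero _ hn)]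
  simp [f4Root, Fin.sum_univ_succ]
  ring

/-- The linear programming bound given by the polynomial `(1 - x) (1 - 8 x / 3) ^ 2` is `10`.
It is not attained: in case of equality `x` takes only the values `0`, `3 / 8` and `1`, and the
value `3 / 8` would be taken `64 / 5` times. -/
theorem card_filter_eq_zero_le_nine_of_moments {ι : Type*} [Fintype ι] (x : ι → ℝ)
    (hcard : Fintype.card ι = 24) (hx : ∀ i, x i ≤ 1) (h1 : ∑ i, x i = 6)
    (h2 : ∑ i, x i ^ 2 = 3) (h3 : ∑ i, x i ^ 3 = 15 / 8) :
    (Finset.univ.filter fun i => x i = 0).card ≤ 9 := by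
  classical
  by_contra! hlt
  have hsum : ∑ i, (1 - x i) * (1 - 8 / 3 * x i) ^ 2 = 10 := by
    have hexp (i : ι) : (1 - x i) * (1 - 8 / 3 * x i) ^ 2 =
        1 - 19 / 3 * x i + 112 / 9 * x i ^ 2 - 64 / 9 * x i ^ 3 := by ring
    simp only [hexp, Finset.sum_add_distrib, Finset.sum_sub_distrib, ← Finset.mul_sum, h1, h2, h3]
    norm_num [hcard]
  have hnonneg (i : ι) :
      0 ≤ (1 - x i) * (1 - 8 / 3 * x i) ^ 2 - if x i = 0 then (1 : ℝ) else 0 := by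
    split_ifs with h
    · simp [h]
    · simpa using mul_nonneg (sub_nonneg.mpr (hx i)) (sq_nonneg _)
  have hle : ∑ i, ((1 - x i) * (1 - 8 / 3 * x i) ^ 2 - if x i = 0 then (1 : ℝ) else 0) ≤ 0 := by
    rw [Finset.sum_sub_distrib, hsum, Finset.sum_boole]
    have : (10 : ℝ) ≤ (Finset.univ.filter fun i => x i = 0).card := by exact_mod_cast hlt
    linarith
  have hzero := (Finset.sum_eq_zero_iff_of_nonneg fun i _ => hnonneg i).mp
    (le_antisymm hle (Finset.sum_nonneg fun i _ => hnonneg i))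
  have hval (i : ι) : x i - x i ^ 2 = 15 / 64 * if x i = 3 / 8 then (1 : ℝ) else 0 := by
    have hi := hzero i (Finset.mem_univ i)
    by_cases h0 : x i = 0
    · norm_num [h0]
    · rw [if_neg h0, sub_zero, mul_eq_zero, sq_eq_zero_iff] at hi
      rcases hi with hi | hi
      · rw [← sub_eq_zero.mp hi]
        norm_num
      · rw [show x i = 3 / 8 by linarith]
        norm_num
  have hcount : (6 : ℝ) - 3 = 15 / 64 * (Finset.univ.filter fun i => x i = 3 / 8).card := by
    rw [← Finset.sum_boole, Finset.mul_sum, ← Finset.sum_congr rfl fun i _ => hval i,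
      Finset.sum_sub_distrib, h1, h2]
  have hnat : 64 = 5 * (Finset.univ.filter fun i => x i = 3 / 8).card := by
    have : (64 : ℝ) = 5 * (Finset.univ.filter fun i => x i = 3 / 8).card := by linarith
    exact_mod_cast this
  omega

/-- for every nonzero `a ∈ ℝ⁴`, at most `9` of the 24 positive roots of
`F₄` are orthogonal to `a` (Euclidean inner product zero). -/
theorem stmt_16 (a : Fin 4 → ℝ) (ha : a ≠ 0) :
    Set.ncard {α ∈ F4PositiveRoots | ∑ i, α i * a i = 0} ≤ 9 := by
  classical
  have hsub : {α ∈ F4PositiveRoots | ∑ i, α i * a i = 0} ⊆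
      ((Finset.univ.filter fun i => f4CosSq a i = 0).image f4Root : Finset (Fin 4 → ℝ)) := by
    rintro α ⟨hα, h⟩
    obtain ⟨i, rfl⟩ := F4PositiveRoots_subset_range hα
    simp only [Finset.coe_image, Finset.coe_filter, Finset.mem_univ, true_and]
    exact ⟨i, by simp [f4CosSq, h], rfl⟩
  calc Set.ncard {α ∈ F4PositiveRoots | ∑ i, α i * a i = 0}
      ≤ ((Finset.univ.filter fun i => f4CosSq a i = 0).image f4Root).card := by
        rw [← Set.ncard_coe_finset]
        exact Set.ncard_le_ncard hsub (Finset.finite_toSet _)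
    _ ≤ (Finset.univ.filter fun i => f4CosSq a i = 0).card := Finset.card_image_le
    _ ≤ 9 := card_filter_eq_zero_le_nine_of_moments _ (Fintype.card_fin 24) (f4CosSq_le_one a)
        (sum_f4CosSq ha) (sum_f4CosSq_sq ha) (sum_f4CosSq_cube ha)
end

section
/- Let n ≥ 2 and let η_0 ≥ 1, η_1 ≥ 0, η_2 ≥ 0 be integers with η_0(2n−3) + η_1 + η_2 > n. Then the integral over the region {λ ∈ ℝ^n : λ_1 ≥ λ_2 ≥ ⋯ ≥ λ_n ≥ 0} of the function λ ↦ ∏_{1 ≤ i < j ≤ n} [(1 + λ_i − λ_j)(1 + λ_i + λ_j)]^{−η_0} · ∏_{i=1}^n (1 + λ_i)^{−η_1}(1 + 2λ_i)^{−η_2} with respect to Lebesgue measure is finite. -/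
open MeasureTheory

/-- The matrix sending `l` to its consecutive gaps `l i - l (i + 1)`, the last coordinate being
kept. -/
def gapMatrix (n : ℕ) : Matrix (Fin n) (Fin n) ℝ :=
  Matrix.of fun i j => (if j = i then 1 else 0) - if j.val = i.val + 1 then 1 else 0

lemma det_gapMatrix (n : ℕ) : (gapMatrix n).det = 1 := by
  rw [Matrix.det_of_isUpperTriangular]
  · simp [gapMatrix]
  · intro i j hij
    have hij : j < i := hij
    have h₁ : j ≠ i := hij.ne
    have h₂ : j.val ≠ i.val + 1 := by have : j.val < i.val := hij; omega
    simp [gapMatrix, h₁, h₂]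

lemma gapMatrix_mulVec_of_succ {n : ℕ} (l : Fin n → ℝ) {i j : Fin n} (h : j.val = i.val + 1) :
    Matrix.toLin' (gapMatrix n) l i = l i - l j := by
  have hj (k : Fin n) : k.val = i.val + 1 ↔ k = j := by rw [← h, Fin.val_inj]
  simp [gapMatrix, Matrix.mulVec, dotProduct, sub_mul, Finset.sum_sub_distrib, hj]

lemma gapMatrix_mulVec_last {n : ℕ} (l : Fin n → ℝ) {i : Fin n} (h : i.val + 1 = n) :
    Matrix.toLin' (gapMatrix n) l i = l i := by
  have hj (k : Fin n) : k.val ≠ i.val + 1 := by omega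
  simp [gapMatrix, Matrix.mulVec, dotProduct, hj]

lemma measurePreserving_gapMatrix (n : ℕ) :
    MeasurePreserving (Matrix.toLin' (gapMatrix n)) := by
  refine ⟨(LinearMap.continuous_of_finiteDimensional _).measurable, ?_⟩
  rw [Real.map_matrix_volume_pi_eq_smul_volume_pi (by simp [det_gapMatrix])]
  simp [det_gapMatrix]

lemma integrable_prod_inv_one_add_sq_gap (n : ℕ) :
    Integrable fun l : Fin n → ℝ =>
      ∏ i, (1 + Matrix.toLin' (gapMatrix n) l i ^ 2)⁻¹ :=
  (measurePreserving_gapMatrix n).integrable_comp_of_integrable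
    (Integrable.fintype_prod fun _ : Fin n => integrable_inv_one_add_sq)

/-- The contribution of the roots `e_i ± e_j` to the reciprocal of the integrand. -/
lemma one_le_root_pair {a b : ℝ} (hb : 0 ≤ b) (hab : b ≤ a) :
    1 ≤ (1 + a - b) * (1 + a + b) :=
  one_le_mul_of_one_le_of_one_le (by linarith) (by linarith)

lemma one_add_sq_sub_le_root_pair {a b : ℝ} (hb : 0 ≤ b) (hab : b ≤ a) :
    1 + (a - b) ^ 2 ≤ (1 + a - b) * (1 + a + b) := by
  nlinarith [mul_nonneg hb (sub_nonneg.2 hab)]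

lemma one_add_sq_mul_le_root_pairs {a b c d : ℝ} (hd : 0 ≤ d) (hdc : d ≤ c) (hcb : c ≤ b)
    (hba : b ≤ a) :
    (1 + (a - b) ^ 2) * (1 + d ^ 2) ≤
      ((1 + a - b) * (1 + a + b)) * ((1 + a - c) * (1 + a + c)) := by
  have h₁ : 1 + (a - b) ^ 2 ≤ (1 + a - b) * (1 + a - c) := by
    nlinarith [mul_nonneg (sub_nonneg.2 hba) (sub_nonneg.2 hcb)]
  have h₂ : 1 + d ^ 2 ≤ (1 + a + b) * (1 + a + c) := by
    nlinarith [mul_nonneg hd hd, mul_self_nonneg a,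
      mul_le_mul (by linarith : d ≤ 1 + a + b) (by linarith : d ≤ a + c) hd (by linarith)]
  calc _ ≤ ((1 + a - b) * (1 + a - c)) * ((1 + a + b) * (1 + a + c)) :=
        mul_le_mul h₁ h₂ (by positivity) (le_trans (by positivity) h₁)
    _ = _ := by ring

/-- In rank at least three the roots `e_i ± e_j` alone dominate the product over the gaps. -/
lemma prod_one_add_sq_gap_le_prod_root_pair {m : ℕ} {l : Fin (m + 3) → ℝ}
    (hl : Antitone l) (h0 : ∀ i, 0 ≤ l i) :
    ∏ i, (1 + Matrix.toLin' (gapMatrix (m + 3)) l i ^ 2) ≤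
      ∏ i, ∏ j ∈ Finset.Ioi i, (1 + l i - l j) * (1 + l i + l j) := by
  have hA {i j : Fin (m + 3)} (hij : i < j) : 1 ≤ (1 + l i - l j) * (1 + l i + l j) :=
    one_le_root_pair (h0 j) (hl hij.le)
  have hsub (i : Fin (m + 3)) (s : Finset (Fin (m + 3))) (hs : s ⊆ Finset.Ioi i) :
      ∏ j ∈ s, (1 + l i - l j) * (1 + l i + l j) ≤
        ∏ j ∈ Finset.Ioi i, (1 + l i - l j) * (1 + l i + l j) :=
    Finset.prod_le_prod_of_subset_of_one_le hs
      (fun j hj => zero_le_one.trans (hA (Finset.mem_Ioi.1 (hs hj))))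
      fun j hj _ => hA (Finset.mem_Ioi.1 hj)
  have hfirst : (1 + Matrix.toLin' (gapMatrix (m + 3)) l 0 ^ 2) *
      (1 + Matrix.toLin' (gapMatrix (m + 3)) l (Fin.last _) ^ 2) ≤
        ∏ j ∈ Finset.Ioi 0, (1 + l 0 - l j) * (1 + l 0 + l j) := by
    let a : Fin (m + 3) := ⟨1, by omega⟩
    let b : Fin (m + 3) := ⟨2, by omega⟩
    have hab : a ≠ b := by simp [a, b]
    refine le_trans ?_ (hsub 0 {a, b} ?_)
    · rw [Finset.prod_pair hab, gapMatrix_mulVec_of_succ l (i := 0) (j := a) (by simp [a]),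
        gapMatrix_mulVec_last l (by simp)]
      exact one_add_sq_mul_le_root_pairs (h0 _) (hl (Fin.le_last _))
        (hl (by simp [a, b, Fin.le_def])) (hl (Fin.zero_le _))
    · intro j hj
      have : j = a ∨ j = b := by simpa using hj
      rcases this with rfl | rfl <;> simp [a, b]
  have hmid (i : Fin (m + 1)) :
      1 + Matrix.toLin' (gapMatrix (m + 3)) l i.castSucc.succ ^ 2 ≤
        ∏ j ∈ Finset.Ioi i.castSucc.succ,
          (1 + l i.castSucc.succ - l j) * (1 + l i.castSucc.succ + l j) := by
    have hlt : i.castSucc.succ < i.succ.succ := by simp [Fin.lt_def]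
    refine le_trans ?_ (hsub _ {i.succ.succ} (by simp))
    rw [Finset.prod_singleton, gapMatrix_mulVec_of_succ l (j := i.succ.succ) (by simp)]
    exact one_add_sq_sub_le_root_pair (h0 _) (hl hlt.le)
  rw [Fin.prod_univ_succ, Fin.prod_univ_castSucc, Fin.prod_univ_succ (n := m + 2),
    Fin.prod_univ_castSucc (n := m + 1), Fin.succ_last, mul_comm (∏ i : Fin (m + 1), _),
    ← mul_assoc]
  have hlast : ∏ j ∈ Finset.Ioi (Fin.last (m + 2)),
      (1 + l (Fin.last (m + 2)) - l j) * (1 + l (Fin.last (m + 2)) + l j) = 1 := by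
    rw [← Fin.top_eq_last, Finset.Ioi_top, Finset.prod_empty]
  rw [hlast, mul_one]
  exact mul_le_mul hfirst (Finset.prod_le_prod (fun _ _ => by positivity) fun i _ => hmid i)
    (by positivity) (le_trans (by positivity) hfirst)

/-- The rank two estimate. -/
lemma one_add_sq_gap_mul_le_of_two {η₀ m : ℕ} (hη₀ : 1 ≤ η₀) (h : 2 < η₀ + m) {a b : ℝ}
    (hb : 0 ≤ b) (hab : b ≤ a) :
    (1 + (a - b) ^ 2) * (1 + b ^ 2) ≤
      ((1 + a - b) * (1 + a + b)) ^ η₀ * ((1 + a) ^ m * (1 + b) ^ m) := by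
  have hA := one_le_root_pair hb hab
  have hsq₁ : 1 + (a - b) ^ 2 ≤ (1 + a - b) ^ 2 := by nlinarith
  have hsq₂ : 1 + b ^ 2 ≤ (1 + b) ^ 2 := by nlinarith
  rcases hη₀.eq_or_lt with rfl | h2
  · calc (1 + (a - b) ^ 2) * (1 + b ^ 2)
        ≤ ((1 + a - b) * (1 + a + b)) * (1 + b) ^ 2 := by
          gcongr
          exact one_add_sq_sub_le_root_pair hb hab
      _ ≤ ((1 + a - b) * (1 + a + b)) ^ 1 * (1 * (1 + b) ^ m) := by
          rw [pow_one, one_mul]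
          gcongr
          · linarith
          · omega
      _ ≤ _ := by
          gcongr
          exact one_le_pow₀ (by linarith)
  · calc (1 + (a - b) ^ 2) * (1 + b ^ 2)
        ≤ (1 + a - b) ^ 2 * (1 + a + b) ^ 2 := by
          refine mul_le_mul hsq₁ (hsq₂.trans ?_) (by positivity) (by positivity)
          gcongr
          linarith
      _ = ((1 + a - b) * (1 + a + b)) ^ 2 := by ring
      _ ≤ ((1 + a - b) * (1 + a + b)) ^ η₀ := pow_le_pow_right₀ hA h2
      _ ≤ _ := le_mul_of_one_le_right (by positivity)
          (one_le_mul_of_one_le_of_one_le (one_le_pow₀ (by linarith))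
            (one_le_pow₀ (by linarith)))

lemma prod_one_add_sq_gap_le {n : ℕ} (hn : 2 ≤ n) {η₀ η₁ η₂ : ℕ} (hη₀ : 1 ≤ η₀)
    (hgt : n < η₀ * (2 * n - 3) + η₁ + η₂) {l : Fin n → ℝ} (hl : Antitone l)
    (h0 : ∀ i, 0 ≤ l i) :
    ∏ i, (1 + Matrix.toLin' (gapMatrix n) l i ^ 2) ≤
      (∏ i, ∏ j ∈ Finset.Ioi i, ((1 + l i - l j) * (1 + l i + l j)) ^ η₀) *
        ∏ i, (1 + l i) ^ η₁ * (1 + 2 * l i) ^ η₂ := by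
  have hA {i j : Fin n} (hij : i < j) : 1 ≤ (1 + l i - l j) * (1 + l i + l j) :=
    one_le_root_pair (h0 j) (hl hij.le)
  have hpos : 0 ≤ ∏ i, ∏ j ∈ Finset.Ioi i, ((1 + l i - l j) * (1 + l i + l j)) ^ η₀ :=
    Finset.prod_nonneg fun i _ => Finset.prod_nonneg fun j hj =>
      pow_nonneg (zero_le_one.trans (hA (Finset.mem_Ioi.1 hj))) _
  have hshort (i : Fin n) : (1 + l i) ^ (η₁ + η₂) ≤ (1 + l i) ^ η₁ * (1 + 2 * l i) ^ η₂ := by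
    have := h0 i
    rw [pow_add]
    gcongr
    linarith
  refine le_trans ?_ (mul_le_mul_of_nonneg_left
    (Finset.prod_le_prod (fun i _ => pow_nonneg (by linarith [h0 i]) _) fun i _ => hshort i) hpos)
  obtain rfl | ⟨m, rfl⟩ : n = 2 ∨ ∃ m, n = m + 3 := by
    rcases hn.eq_or_lt with h | h
    · exact .inl h.symm
    · exact .inr ⟨n - 3, by omega⟩
  · have hIoi₀ : Finset.Ioi (0 : Fin 2) = {1} := by decide
    have hIoi₁ : Finset.Ioi (1 : Fin 2) = ∅ := by decide
    rw [Fin.prod_univ_two, Fin.prod_univ_two, Fin.prod_univ_two, hIoi₀, hIoi₁,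
      Finset.prod_singleton, Finset.prod_empty, mul_one,
      gapMatrix_mulVec_of_succ l (i := 0) (j := 1) rfl, gapMatrix_mulVec_last l (i := 1) rfl]
    exact one_add_sq_gap_mul_le_of_two hη₀ (by omega) (h0 1) (hl (Fin.zero_le 1))
  · refine (prod_one_add_sq_gap_le_prod_root_pair hl h0).trans
      (le_trans ?_ (le_mul_of_one_le_right hpos
        (Finset.one_le_prod fun i _ => one_le_pow₀ (by linarith [h0 i]))))
    refine Finset.prod_le_prod (fun i _ => Finset.prod_nonneg fun j hj => ?_)
      fun i _ => Finset.prod_le_prod (fun j hj => ?_) fun j hj => ?_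
    · exact zero_le_one.trans (hA (Finset.mem_Ioi.1 hj))
    · exact zero_le_one.trans (hA (Finset.mem_Ioi.1 hj))
    · exact le_self_pow₀ (hA (Finset.mem_Ioi.1 hj)) (by omega)

/-- types `B_n`, `C_n`, `BC_n` (`n ≥ 2`): if
`η₀(2n−3) + η₁ + η₂ > n`, then the integral over the dominant chamber
`{λ : λ₁ ≥ ⋯ ≥ λ_n ≥ 0}` of
`∏_{i<j} [(1+λ_i−λ_j)(1+λ_i+λ_j)]^{−η₀} · ∏_i (1+λ_i)^{−η₁}(1+2λ_i)^{−η₂}`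
is finite. -/
theorem stmt_18 (n : ℕ) (hn : 2 ≤ n) (η₀ η₁ η₂ : ℕ) (hη₀ : 1 ≤ η₀)
    (hgt : n < η₀ * (2 * n - 3) + η₁ + η₂) :
    ∫⁻ l in {l : Fin n → ℝ | (∀ i j : Fin n, i ≤ j → l j ≤ l i) ∧ ∀ i, 0 ≤ l i},
      ENNReal.ofReal
        ((∏ i : Fin n, ∏ j ∈ Finset.Ioi i,
            (((1 + l i - l j) * (1 + l i + l j)) ^ η₀)⁻¹) *
          ∏ i : Fin n, ((1 + l i) ^ η₁)⁻¹ * ((1 + 2 * l i) ^ η₂)⁻¹) < ⊤ := by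
  refine lt_of_le_of_lt ?_ (integrable_prod_inv_one_add_sq_gap n).lintegral_lt_top
  refine le_trans (lintegral_mono_ae ?_) (setLIntegral_le_lintegral _ _)
  have hmeas : MeasurableSet
      {l : Fin n → ℝ | (∀ i j : Fin n, i ≤ j → l j ≤ l i) ∧ ∀ i, 0 ≤ l i} := by
    measurability
  refine (ae_restrict_mem hmeas).mono fun l hl => ENNReal.ofReal_le_ofReal ?_
  have hle := inv_anti₀ (Finset.prod_pos fun i _ => by positivity)
    (prod_one_add_sq_gap_le hn hη₀ hgt (fun i j => hl.1 i j) hl.2)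
  simpa only [mul_inv, Finset.prod_mul_distrib, Finset.prod_inv_distrib] using hle
end

section
/- Let n ≥ 4 and let η_0 ≥ 1 be an integer. Then the integral over the region {λ ∈ ℝ^n : λ_1 ≥ λ_2 ≥ ⋯ ≥ λ_{n−1} ≥ |λ_n|} of the function λ ↦ ∏_{1 ≤ i < j ≤ n} [(1 + λ_i − λ_j)(1 + λ_i + λ_j)]^{−η_0} with respect to Lebesgue measure is finite. -/
open MeasureTheory

lemma abs_le_of_mem_chamber {n : ℕ} (hn : 2 ≤ n) {l : Fin n → ℝ}
    (hdec : ∀ i j : Fin n, i ≤ j → (j : ℕ) < n - 1 → l j ≤ l i)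
    (hlast : |l ⟨n - 1, by omega⟩| ≤ l ⟨n - 2, by omega⟩) {i j : Fin n} (hij : i < j) :
    |l j| ≤ l i := by
  have hij' : (i : ℕ) < j := hij
  by_cases hj : (j : ℕ) < n - 1
  · have hpos : l ⟨n - 2, by omega⟩ ≤ l j :=
      hdec j ⟨n - 2, by omega⟩ (Fin.mk_le_mk.2 (by omega)) (by simp only; omega)
    rw [abs_of_nonneg (((abs_nonneg _).trans hlast).trans hpos)]
    exact hdec i j hij.le hj
  · have hj' : j = ⟨n - 1, by omega⟩ := Fin.ext (by simp only; omega)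
    rw [hj']
    exact hlast.trans
      (hdec i ⟨n - 2, by omega⟩ (Fin.mk_le_mk.2 (by omega)) (by simp only; omega))

lemma sqrt_mul_sqrt_le_of_abs_le {a b : ℝ} (h : |b| ≤ a) :
    √(1 + |a|) * √(1 + |b|) ≤ (1 + a - b) * (1 + a + b) := by
  have ha : 0 ≤ a := (abs_nonneg b).trans h
  have hb := abs_nonneg b
  rw [abs_of_nonneg ha]
  calc √(1 + a) * √(1 + |b|) ≤ √(1 + a) * √(1 + a) := by gcongr
    _ = 1 + a := Real.mul_self_sqrt (by positivity)
    _ ≤ (1 + a - b) * (1 + a + b) := by nlinarith [sq_abs b]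

lemma prod_prod_Ioi_mul_eq_prod_pow {M : Type*} [CommMonoid M] {n : ℕ} (f : Fin n → M) :
    ∏ i, ∏ j ∈ Finset.Ioi i, f i * f j = ∏ i, f i ^ (n - 1) := by
  rw [Finset.prod_prod_Ioi_mul_eq_prod_prod_off_diag (fun _ i : Fin n => f i)]
  simp [Finset.card_compl]

lemma prod_inv_pow_le_prod_rpow {n : ℕ} (hn : 4 ≤ n) {k : ℕ} (hk : 1 ≤ k) {l : Fin n → ℝ}
    (hl : ∀ i j : Fin n, i < j → |l j| ≤ l i) :
    ∏ i : Fin n, ∏ j ∈ Finset.Ioi i, (((1 + l i - l j) * (1 + l i + l j)) ^ k)⁻¹ ≤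
      ∏ i, (1 + ‖l i‖) ^ (-(3 / 2) : ℝ) := by
  have hs : ∀ i, 1 ≤ √(1 + |l i|) := fun i =>
    Real.one_le_sqrt.2 (by linarith [abs_nonneg (l i)])
  calc ∏ i : Fin n, ∏ j ∈ Finset.Ioi i, (((1 + l i - l j) * (1 + l i + l j)) ^ k)⁻¹
      ≤ ∏ i : Fin n, ∏ j ∈ Finset.Ioi i, ((√(1 + |l i|))⁻¹ * (√(1 + |l j|))⁻¹) := by
        have key : ∀ i j : Fin n, j ∈ Finset.Ioi i →
            1 ≤ √(1 + |l i|) * √(1 + |l j|) ∧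
            √(1 + |l i|) * √(1 + |l j|) ≤ (1 + l i - l j) * (1 + l i + l j) := fun i j hj =>
          ⟨one_le_mul_of_one_le_of_one_le (hs i) (hs j),
            sqrt_mul_sqrt_le_of_abs_le (hl i j (Finset.mem_Ioi.1 hj))⟩
        have hnonneg : ∀ i j : Fin n, j ∈ Finset.Ioi i →
            0 ≤ (((1 + l i - l j) * (1 + l i + l j)) ^ k)⁻¹ := fun i j hj => by
          obtain ⟨h1, h2⟩ := key i j hj
          exact inv_nonneg.2 (pow_nonneg (by linarith) k)
        refine Finset.prod_le_prod (fun i _ => Finset.prod_nonneg (hnonneg i)) fun i _ =>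
          Finset.prod_le_prod (hnonneg i) fun j hj => ?_
        obtain ⟨h1, h2⟩ := key i j hj
        rw [← mul_inv]
        exact inv_anti₀ (by linarith) (h2.trans (le_self_pow₀ (h1.trans h2) (by omega)))
    _ = ∏ i, (√(1 + |l i|))⁻¹ ^ (n - 1) :=
        prod_prod_Ioi_mul_eq_prod_pow fun i => (√(1 + |l i|))⁻¹
    _ ≤ ∏ i, (1 + ‖l i‖) ^ (-(3 / 2) : ℝ) := by
        refine Finset.prod_le_prod (fun i _ => by positivity) fun i _ => ?_
        calc (√(1 + |l i|))⁻¹ ^ (n - 1) ≤ (√(1 + |l i|))⁻¹ ^ 3 :=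
              pow_le_pow_of_le_one (by positivity) (inv_le_one_of_one_le₀ (hs i)) (by omega)
          _ = (1 + ‖l i‖) ^ (-(3 / 2) : ℝ) := by
              have hx : 0 ≤ 1 + |l i| := by positivity
              rw [Real.norm_eq_abs, Real.sqrt_eq_rpow, ← Real.rpow_neg hx, ← Real.rpow_natCast,
                ← Real.rpow_mul hx]
              norm_num

/-- type `D_n` (`n ≥ 4`): the integral over the dominant chamber
`{λ : λ₁ ≥ ⋯ ≥ λ_{n−1} ≥ |λ_n|}` of
`∏_{i<j} [(1+λ_i−λ_j)(1+λ_i+λ_j)]^{−η₀}` is finite. -/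
theorem stmt_19 (n : ℕ) (hn : 4 ≤ n) (η₀ : ℕ) (hη₀ : 1 ≤ η₀) :
    ∫⁻ l in {l : Fin n → ℝ |
        (∀ i j : Fin n, i ≤ j → (j : ℕ) < n - 1 → l j ≤ l i) ∧
        |l ⟨n - 1, by omega⟩| ≤ l ⟨n - 2, by omega⟩},
      ENNReal.ofReal
        (∏ i : Fin n, ∏ j ∈ Finset.Ioi i,
          (((1 + l i - l j) * (1 + l i + l j)) ^ η₀)⁻¹) < ⊤ := by
  have hint : Integrable (fun l : Fin n → ℝ => ∏ i, (1 + ‖l i‖) ^ (-(3 / 2) : ℝ)) :=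
    Integrable.fintype_prod fun _ => integrable_one_add_norm (by norm_num)
  refine lt_of_le_of_lt ?_ hint.lintegral_lt_top
  refine (setLIntegral_mono (by fun_prop) fun l hl => ?_).trans (setLIntegral_le_lintegral _ _)
  exact ENNReal.ofReal_le_ofReal (prod_inv_pow_le_prod_rpow hn hη₀ fun i j hij =>
    abs_le_of_mem_chamber (by omega) hl.1 hl.2 hij)
end
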